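/- arXiv:math/0609723 — 2 statements merged into one kernel-verified Lean document; each statement's English description precedes it below -/
import Mathlib

section
/- Let h be an odd prime with h ≠ p and let d = gcd(h−1, p−1). Suppose c is an ideal class of O_K of order h such that σ(c) = c^ν for some integer ν. Then: (i) Σ_{i=0}^{p-2} v_{-i}·ν^i ≡ 0 (mod h); (ii) ν^d ≡ 1 (mod h); (iii) if moreover d < p−1, then Σ_{i=0}^{d-1} ν^i · ((Σ_{j=0}^{(p-1)/d − 1} v_{-(i+jd)})/p) ≡ 0 (mod h), the inner sums being divisible by p. -/
open NumberField Finset nonZeroDivisors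

lemma aux_sum_pow (l : ℕ) [Fact l.Prime] (a b : ℕ) (h : a + b < l - 1) :
    ∑ x : ZMod l, x ^ a * (1 - x) ^ b = 0 := by
  have key : ∀ x : ZMod l, x ^ a * (1 - x) ^ b =
      ∑ i ∈ range (b + 1), (-1 : ZMod l) ^ i * (b.choose i : ZMod l) * x ^ (a + i) := by
    intro x
    rw [sub_eq_neg_add, add_pow, Finset.mul_sum]
    refine Finset.sum_congr rfl fun i _ => ?_
    rw [neg_pow x]; ring
  simp_rw [key]
  rw [Finset.sum_comm]
  refine Finset.sum_eq_zero fun i hi => ?_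
  rw [← Finset.mul_sum, FiniteField.sum_pow_lt_card_sub_one, mul_zero]
  rw [ZMod.card]
  have := Finset.mem_range.1 hi
  omega

lemma aux_char {R : Type*} [CommRing R] [IsDomain R] (p l : ℕ) (hp : p.Prime) [Fact l.Prime]
    (z : R) (hz : IsPrimitiveRoot z p) (π : R →+* ZMod l) (hπ : IsPrimitiveRoot (π z) p) :
    ∃ (χ : MulChar (ZMod l) R) (m : ℕ), l - 1 = p * m ∧ 0 < m ∧ orderOf χ = p ∧
      ∀ x : ZMod l, x ≠ 0 → π (χ x) = x ^ ((p - 1) * m) := by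
  classical
  have hl : l.Prime := Fact.out
  obtain ⟨g, hg⟩ := IsCyclic.exists_generator (α := (ZMod l)ˣ)
  have hog : orderOf g = l - 1 := by
    rw [orderOf_eq_card_of_forall_mem_zpowers hg, Nat.card_eq_fintype_card, ZMod.card_units]
  have hdvd : p ∣ l - 1 := by
    rw [hπ.eq_orderOf]
    refine orderOf_dvd_of_pow_eq_one (ZMod.pow_card_sub_one_eq_one (hπ.ne_zero hp.ne_zero))
  obtain ⟨m, hm⟩ := hdvd
  have hl2 := hl.two_le
  have hm0 : 0 < m := by
    rcases Nat.eq_zero_or_pos m with h | h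
    · subst h; omega
    · exact h
  have : NeZero p := ⟨hp.ne_zero⟩
  have hgp : ((g : ZMod l) ^ ((p - 1) * m)) ^ p = 1 := by
    rw [← pow_mul, show (p - 1) * m * p = (l - 1) * (p - 1) by rw [hm]; ring, pow_mul,
      ZMod.pow_card_sub_one_eq_one g.ne_zero, one_pow]
  obtain ⟨e, he, hge⟩ := hπ.eq_pow_of_pow_eq_one hgp
  obtain ⟨u, hu⟩ := hz.isUnit hp.ne_zero
  have hup : u ^ p = 1 := by
    ext; push_cast; rw [hu]; exact hz.pow_eq_one
  have hroot : u ^ e ∈ rootsOfUnity (Fintype.card (ZMod l)ˣ) R := by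
    rw [mem_rootsOfUnity, ZMod.card_units, hm, ← pow_mul, show e * (p * m) = p * (e * m) by ring,
      pow_mul, hup, one_pow]
  set χ := MulChar.ofRootOfUnity hroot hg with hχ
  have hχg : χ g = z ^ e := by
    rw [hχ, MulChar.ofRootOfUnity_spec]; push_cast; rw [hu]
  have hval : ∀ x : ZMod l, x ≠ 0 → π (χ x) = x ^ ((p - 1) * m) := by
    intro x hx
    obtain ⟨y, rfl⟩ := hx.isUnit
    obtain ⟨n, hn⟩ := (Submonoid.mem_powers_iff _ _).1 ((mem_powers_iff_mem_zpowers).2 (hg y))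
    rw [← hn]; push_cast
    rw [map_pow, hχg, map_pow, map_pow, hge, ← pow_mul, ← pow_mul, mul_comm]
  refine ⟨χ, m, hm, hm0, ?_, hval⟩
  have : Fact p.Prime := ⟨hp⟩
  refine orderOf_eq_prime ?_ ?_
  · rw [MulChar.eq_iff hg, MulChar.pow_apply_coe, hχg, ← pow_mul, mul_comm, pow_mul, hz.pow_eq_one,
      one_pow, MulChar.one_apply_coe]
  · intro h1
    have h2 := hval g g.ne_zero
    rw [h1, MulChar.one_apply_coe, map_one] at h2
    have h3 : g ^ ((p - 1) * m) = 1 := by ext; push_cast; exact h2.symm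
    have h4 := orderOf_dvd_of_pow_eq_one h3
    rw [hog, hm] at h4
    have h5 := Nat.dvd_of_mul_dvd_mul_right hm0 h4
    have := Nat.le_of_dvd (by have := hp.two_le; omega) h5
    have := hp.two_le
    omega

lemma aux_jac_zero {R : Type*} [CommRing R] [IsDomain R] (p l : ℕ) (hp : p.Prime) [Fact l.Prime]
    (π : R →+* ZMod l) (χ : MulChar (ZMod l) R) (m : ℕ) (hm : l - 1 = p * m) (hm0 : 0 < m)
    (hχ : ∀ x : ZMod l, x ≠ 0 → π (χ x) = x ^ ((p - 1) * m))
    (a b : ℕ) (ha : 0 < a) (ha' : a < p) (hb : 0 < b) (hb' : b < p) (hab : p < a + b) :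
    π (jacobiSum (χ ^ a) (χ ^ b)) = 0 := by
  have key : ∀ a : ℕ, 0 < a → a < p → ∀ x : ZMod l, π ((χ ^ a) x) = x ^ ((p - a) * m) := by
    intro a ha ha' x
    by_cases hx : x = 0
    · subst hx
      rw [MulChar.map_zero, map_zero, zero_pow]
      have : 0 < p - a := by omega
      positivity
    · rw [MulChar.pow_apply' _ ha.ne', map_pow, hχ x hx, ← pow_mul]
      have h1 : x ^ (p * m) = 1 := by rw [← hm]; exact ZMod.pow_card_sub_one_eq_one hx
      have : (p - 1) * m * a = (p * m) * (a - 1) + (p - a) * m := by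
        obtain ⟨k, rfl⟩ := Nat.exists_eq_add_of_lt ha'
        obtain ⟨c, rfl⟩ := Nat.exists_eq_add_of_lt ha
        simp only [Nat.zero_add, Nat.add_sub_cancel]
        rw [show c + 1 + k + 1 - (c + 1) = k + 1 by omega]
        ring
      rw [this, pow_add, pow_mul, h1, one_pow, one_mul]
  rw [jacobiSum, map_sum]
  simp_rw [map_mul, key a ha ha', key b hb hb']
  apply aux_sum_pow
  rw [hm, ← add_mul]
  refine Nat.mul_lt_mul_of_pos_right ?_ hm0
  omega

lemma aux_comp {R : Type*} [CommRing R] [IsDomain R] (p l : ℕ) (hp : p.Prime) [Fact l.Prime]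
    (z : R) (hz : IsPrimitiveRoot z p) (χ : MulChar (ZMod l) R) (hχ : χ ^ p = 1)
    (τ : R →+* R) (t : ℕ) (hτ : τ z = z ^ t) : χ.ringHomComp τ = χ ^ t := by
  have : NeZero p := ⟨hp.ne_zero⟩
  ext x
  obtain ⟨k, _, hk⟩ := MulChar.exists_apply_eq_pow hχ hz x.ne_zero
  rw [MulChar.ringHomComp_apply, MulChar.pow_apply_coe, hk, map_pow, hτ, ← pow_mul, ← pow_mul,
    mul_comm]

lemma aux_jac_mul {R K : Type*} [CommRing R] [IsDomain R] [Field K] [CharZero K] (f : R →+* K)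
    (hf : Function.Injective f)
    (l : ℕ) [Fact l.Prime] (χ φ : MulChar (ZMod l) R) (h1 : χ ≠ 1) (h2 : φ ≠ 1)
    (h3 : χ * φ ≠ 1) : jacobiSum χ φ * jacobiSum χ⁻¹ φ⁻¹ = l := by
  apply hf
  have hl : l.Prime := Fact.out
  rw [map_mul, ← jacobiSum_ringHomComp, ← jacobiSum_ringHomComp, ← MulChar.ringHomComp_inv,
    ← MulChar.ringHomComp_inv, jacobiSum_mul_jacobiSum_inv, ZMod.card, map_natCast]
  · rw [ringChar.eq_zero, ZMod.ringChar_zmod_n]; exact hl.ne_zero.symm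
  · exact (MulChar.ringHomComp_ne_one_iff hf).2 h1
  · exact (MulChar.ringHomComp_ne_one_iff hf).2 h2
  · rw [← MulChar.ringHomComp_mul]
    exact (MulChar.ringHomComp_ne_one_iff hf).2 h3

lemma aux_count (p t : ℕ) (hp : p.Prime) (ht : 0 < t) (ht' : t < p) :
    ((Ico 1 (p - 1)).filter (fun k => p < t + (k * t) % p)).card = t - 1 := by
  classical
  have hcop : Nat.Coprime t p := ((Nat.Prime.coprime_iff_not_dvd hp).2 fun h => by
    have := Nat.le_of_dvd ht h
    omega).symm
  have hinj : ∀ k k', k < p → k' < p → (k * t) % p = (k' * t) % p → k = k' := by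
    intro k k' hk hk' h
    have h1 : k ≡ k' [MOD p] := Nat.ModEq.cancel_right_of_coprime (by
      rwa [Nat.coprime_comm] at hcop) h
    exact Nat.ModEq.eq_of_lt_of_lt h1 hk hk'
  have himg : ((Ico 1 (p - 1)).filter (fun k => p < t + (k * t) % p)).image (fun k => (k * t) % p)
      = Ico (p - t + 1) p := by
    ext b
    simp only [mem_image, mem_filter, mem_Ico]
    constructor
    · rintro ⟨k, ⟨_, h⟩, rfl⟩
      exact ⟨by omega, Nat.mod_lt _ hp.pos⟩
    · rintro ⟨h1, h2⟩
      -- surjectivity on residues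
      have hsurj : Function.Surjective (fun k : Fin p => (⟨(k.1 * t) % p, Nat.mod_lt _ hp.pos⟩ : Fin p)) := by
        apply Finite.surjective_of_injective
        intro k k' h
        have := Fin.mk.inj h
        exact Fin.ext (hinj _ _ k.2 k'.2 this)
      obtain ⟨k, hk⟩ := hsurj ⟨b, h2⟩
      have hk' : (k.1 * t) % p = b := Fin.mk.inj hk
      refine ⟨k.1, ⟨⟨?_, ?_⟩, by omega⟩, hk'⟩
      · rcases Nat.eq_zero_or_pos k.1 with h | h
        · rw [h, zero_mul, Nat.zero_mod] at hk'; omega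
        · exact h
      · have hk2 := k.2
        by_contra hcon
        have hkp : k.1 = p - 1 := by omega
        rw [hkp] at hk'
        have : (p - 1) * t = (p - t) + p * (t - 1) := by
          obtain ⟨c, rfl⟩ := Nat.exists_eq_add_of_lt ht'
          obtain ⟨c', rfl⟩ := Nat.exists_eq_add_of_lt ht
          simp only [Nat.zero_add, Nat.add_sub_cancel]
          rw [show c' + 1 + c + 1 - (c' + 1) = c + 1 by omega]
          ring
        rw [this, Nat.add_mul_mod_self_left, Nat.mod_eq_of_lt (by omega)] at hk'
        omega
  have hc := Finset.card_image_of_injOn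
    (s := (Ico 1 (p - 1)).filter (fun k => p < t + (k * t) % p)) (f := fun k => (k * t) % p) (by
      intro k hk k' hk' h
      simp only [coe_filter, mem_Ico, Set.mem_ofPred_eq] at hk hk'
      exact hinj _ _ (by omega) (by omega) h)
  rw [himg, Nat.card_Ico] at hc
  omega

lemma aux_group {G : Type*} [CommGroup G] (p : ℕ) (hp : p.Prime) (n : ℕ) (t : ℕ → ℕ)
    (ht : ∀ i, 0 < t i) (ht' : ∀ i, t i < p) (x : ℕ → G) (h0 : ∏ i ∈ range n, x i = 1)
    (hk : ∀ k, 1 ≤ k → k < p - 1 →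
      ∏ i ∈ (range n).filter (fun i => p < t i + (k * t i) % p), x i = 1) :
    ∏ i ∈ range n, x i ^ t i = 1 := by
  have h1 : ∀ i, x i ^ t i = x i * ∏ k ∈ Ico 1 (p - 1),
      (if p < t i + (k * t i) % p then x i else 1) := by
    intro i
    rw [← Finset.prod_filter, Finset.prod_const, aux_count p (t i) hp (ht i) (ht' i), ← pow_succ',
      Nat.sub_add_cancel (ht i)]
  simp_rw [h1]
  rw [Finset.prod_mul_distrib, h0, one_mul, Finset.prod_comm]
  refine Finset.prod_eq_one fun k hk' => ?_
  rw [mem_Ico] at hk'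
  rw [← Finset.prod_filter]
  exact hk k hk'.1 hk'.2

lemma aux_absNorm_ker {K : Type*} [Field K] [NumberField K] (l : ℕ) [Fact l.Prime]
    (π : 𝓞 K →+* ZMod l) : Ideal.absNorm (RingHom.ker π) = l := by
  rw [Ideal.absNorm_apply, Submodule.cardQuot_apply]
  rw [Nat.card_congr (RingHom.quotientKerEquivOfSurjective (ZMod.ringHom_surjective π)).toEquiv,
    Nat.card_zmod]

lemma aux_dvd_eq {K : Type*} [Field K] [NumberField K] (I J : Ideal (𝓞 K)) (h : I ∣ J)
    (hJ : J ≠ ⊥) (hn : Ideal.absNorm I = Ideal.absNorm J) : I = J := by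
  obtain ⟨B, rfl⟩ := h
  rw [map_mul] at hn
  have h0 : Ideal.absNorm I ≠ 0 := by
    rw [Ne, Ideal.absNorm_eq_zero_iff]
    rintro rfl
    exact hJ (by simp)
  have : Ideal.absNorm B = 1 := by
    have h2 : Ideal.absNorm I * 1 = Ideal.absNorm I * Ideal.absNorm B := by rw [mul_one]; exact hn
    exact (Nat.eq_of_mul_eq_mul_left (Nat.pos_of_ne_zero h0) h2).symm
  rw [Ideal.absNorm_eq_one_iff.1 this, Ideal.mul_top]

/-- products of distinct degree one primes -/
lemma aux_deg_one {K : Type*} [Field K] [NumberField K] (p l : ℕ) (hp : p.Prime)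
    [hl : Fact l.Prime] (hfr : Module.finrank ℤ (𝓞 K) = p - 1)
    (z : 𝓞 K) (hz : IsPrimitiveRoot z p) (π : 𝓞 K →+* ZMod l) (hπ : IsPrimitiveRoot (π z) p)
    (τ : ℕ → (𝓞 K ≃+* 𝓞 K)) (t : ℕ → ℕ) (ht : ∀ i, 0 < t i) (ht' : ∀ i, t i < p)
    (hτ : ∀ i, (τ i).symm z = z ^ t i)
    (htinj : ∀ i < p - 1, ∀ j < p - 1, t i = t j → i = j)
    (q : ℕ → (Ideal (𝓞 K))⁰)
    (hq : ∀ i, (q i : Ideal (𝓞 K)) = RingHom.ker (π.comp ((τ i).symm : 𝓞 K →+* 𝓞 K))) :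
    ∏ i ∈ range (p - 1), (ClassGroup.mk0 (q i)) ^ t i = 1 := by
  classical
  have hlp : l.Prime := hl.out
  have hmem : ∀ i x, x ∈ (q i : Ideal (𝓞 K)) ↔ π ((τ i).symm x) = 0 := by
    intro i x
    rw [hq, RingHom.mem_ker]; rfl
  have hmax : ∀ i, (q i : Ideal (𝓞 K)).IsMaximal := by
    intro i
    rw [hq]
    exact RingHom.ker_isMaximal_of_surjective _ (ZMod.ringHom_surjective _)
  have hcop : ∀ s : Finset ℕ, s ⊆ range (p - 1) → (s : Set ℕ).Pairwise
      (Function.onFun IsCoprime fun i => (q i : Ideal (𝓞 K))) := by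
    intro s hs i hi j hj hij
    have hi := mem_range.1 (hs hi)
    have hj := mem_range.1 (hs hj)
    have := hmax i
    have := hmax j
    refine Ideal.isCoprime_of_isMaximal fun h => hij (htinj i hi j hj ?_)
    have h1 : z - ((π z ^ t i).val : 𝓞 K) ∈ (q i : Ideal (𝓞 K)) := by
      rw [hmem, map_sub, hτ, map_natCast, map_sub, map_pow, map_natCast, ZMod.natCast_zmod_val,
        sub_self]
    have h : (q i : Ideal (𝓞 K)) = q j := h
    rw [h, hmem, map_sub, hτ, map_natCast, map_sub, map_pow, map_natCast, ZMod.natCast_zmod_val,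
      sub_eq_zero] at h1
    exact (hπ.pow_inj (ht' j) (ht' i) h1).symm
  have hl0 : Ideal.span {(l : 𝓞 K)} ≠ ⊥ := by
    rw [Ne, Ideal.span_singleton_eq_bot]
    exact_mod_cast hlp.ne_zero
  have hall : ∏ i ∈ range (p - 1), (q i : Ideal (𝓞 K)) = Ideal.span {(l : 𝓞 K)} := by
    refine aux_dvd_eq _ _ (Finset.prod_dvd_of_coprime (hcop _ (Finset.Subset.refl _)) ?_) hl0 ?_
    · intro i _
      rw [Ideal.dvd_span_singleton, hmem, map_natCast, map_natCast, ZMod.natCast_self]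
    · rw [map_prod, Ideal.absNorm_span_natCast, hfr]
      rw [Finset.prod_congr rfl (fun i _ => by rw [hq, aux_absNorm_ker] : ∀ i ∈ range (p - 1), Ideal.absNorm (q i : Ideal (𝓞 K)) = l)]
      rw [Finset.prod_const, card_range]
  have hone : ∀ s : Finset ℕ, (∃ J : 𝓞 K, ∏ i ∈ s, (q i : Ideal (𝓞 K)) = Ideal.span {J}) →
      ∏ i ∈ s, (ClassGroup.mk0 (q i)) = 1 := by
    rintro s ⟨J, hJ⟩
    rw [← map_prod]
    have hJ' : ((∏ i ∈ s, q i : (Ideal (𝓞 K))⁰) : Ideal (𝓞 K)) = Ideal.span {J} := by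
      rw [Submonoid.coe_finsetProd, hJ]
    generalize (∏ i ∈ s, q i : (Ideal (𝓞 K))⁰) = Q at hJ'
    refine (ClassGroup.mk0_eq_one_iff Q.2).2 ?_
    rw [hJ']
    exact ⟨⟨J, rfl⟩⟩
  have hJJ : ∀ s : Finset ℕ, s ⊆ range (p - 1) → ∀ J J' : 𝓞 K, J * J' = l →
      (∀ i ∈ s, J ∈ (q i : Ideal (𝓞 K))) → (∀ i ∈ range (p - 1) \ s, J' ∈ (q i : Ideal (𝓞 K))) →
      ∏ i ∈ s, (q i : Ideal (𝓞 K)) = Ideal.span {J} := by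
    intro s hs J J' hJ h1 h2
    have d1 : ∏ i ∈ s, (q i : Ideal (𝓞 K)) ∣ Ideal.span {J} :=
      Finset.prod_dvd_of_coprime (hcop s hs) fun i hi => by
        rw [Ideal.dvd_span_singleton]; exact h1 i hi
    have d2 : ∏ i ∈ range (p - 1) \ s, (q i : Ideal (𝓞 K)) ∣ Ideal.span {J'} :=
      Finset.prod_dvd_of_coprime (hcop _ sdiff_subset) fun i hi => by
        rw [Ideal.dvd_span_singleton]; exact h2 i hi
    obtain ⟨B, hB⟩ := d1
    obtain ⟨B', hB'⟩ := d2
    have e : Ideal.span {(l : 𝓞 K)} * (B * B') = Ideal.span {(l : 𝓞 K)} * 1 := by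
      rw [mul_one]
      conv_rhs => rw [← hJ, ← Ideal.span_singleton_mul_span_singleton, hB, hB']
      rw [← hall, ← Finset.prod_sdiff hs]
      ring
    have e2 := mul_left_cancel₀ hl0 e
    have : B = 1 := by
      rw [Ideal.one_eq_top, ← Ideal.isUnit_iff]
      exact IsUnit.of_mul_eq_one _ e2
    rw [hB, this, mul_one]
  obtain ⟨χ, m, hm, hm0, hχ, hχv⟩ := aux_char p l hp z hz π hπ
  have hχp : χ ^ p = 1 := by rw [← hχ]; exact pow_orderOf_eq_one χ
  have hpow : ∀ a : ℕ, χ ^ a = 1 ↔ p ∣ a := by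
    intro a; rw [← hχ]; exact orderOf_dvd_iff_pow_eq_one.symm
  have hmod : ∀ a : ℕ, χ ^ a = χ ^ (a % p) := by
    intro a; rw [← hχ]; exact (pow_mod_orderOf _ _).symm
  refine aux_group p hp (p - 1) t ht ht' _ (hone _ ⟨_, hall⟩) ?_
  intro k hk1 hk2
  refine hone _ ⟨jacobiSum (χ ^ 1) (χ ^ k), hJJ _ (filter_subset _ _) _
    (jacobiSum (χ ^ (p - 1)) (χ ^ (p - k))) ?_ ?_ ?_⟩
  · have i1 : (χ ^ 1)⁻¹ = χ ^ (p - 1) := by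
      rw [inv_eq_iff_mul_eq_one, ← pow_add, hpow, Nat.add_sub_cancel' hp.one_le]
    have i2 : (χ ^ k)⁻¹ = χ ^ (p - k) := by
      rw [inv_eq_iff_mul_eq_one, ← pow_add, hpow, Nat.add_sub_cancel' (by omega)]
    rw [← i1, ← i2]
    refine aux_jac_mul (algebraMap (𝓞 K) K) (RingOfIntegers.coe_injective) l _ _ ?_ ?_ ?_
    · rw [Ne, hpow]; exact fun h => by have := Nat.le_of_dvd one_pos h; omega
    · rw [Ne, hpow]; exact fun h => by have := Nat.le_of_dvd (by omega) h; omega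
    · rw [← pow_add, Ne, hpow]; exact fun h => by have := Nat.le_of_dvd (by omega) h; omega
  · intro i hi
    obtain ⟨hi, hlt⟩ := mem_filter.1 hi
    rw [hmem]
    change π (((τ i).symm : 𝓞 K →+* 𝓞 K) _) = 0
    rw [← jacobiSum_ringHomComp, ← MulChar.ringHomComp_pow, ← MulChar.ringHomComp_pow,
      aux_comp p l hp z hz χ hχp _ (t i) (hτ i),
      pow_one, ← pow_mul, hmod (t i * k), mul_comm (t i) k]
    refine aux_jac_zero p l hp π χ m hm hm0 hχv _ _ (ht i) (ht' i) ?_ (Nat.mod_lt _ hp.pos) hlt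
    have := ht' i
    omega
  · intro i hi
    rw [mem_sdiff, mem_filter] at hi
    have hlt : ¬ p < t i + k * t i % p := fun h => hi.2 ⟨hi.1, h⟩
    have hti := ht i
    have hti' := ht' i
    have hnd : ∀ a, 0 < a → a < p → ¬ p ∣ a := fun a h1 h2 h3 => by
      have := Nat.le_of_dvd h1 h3
      omega
    have hb : 0 < k * t i % p := by
      refine Nat.pos_of_ne_zero fun h => ?_
      rcases (hp.dvd_mul).1 (Nat.dvd_of_mod_eq_zero h) with h | h
      · exact hnd k (by omega) (by omega) h
      · exact hnd _ hti hti' h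
    have hbp : k * t i % p < p := Nat.mod_lt _ hp.pos
    have hne : t i + k * t i % p ≠ p := by
      intro h
      have h1 : p ∣ (1 + k) * t i := by
        rw [add_mul, one_mul, Nat.dvd_iff_mod_eq_zero, ← Nat.add_mod_mod, h, Nat.mod_self]
      rcases (hp.dvd_mul).1 h1 with h | h
      · exact hnd (1 + k) (by omega) (by omega) h
      · exact hnd _ hti hti' h
    rw [hmem]
    change π (((τ i).symm : 𝓞 K →+* 𝓞 K) _) = 0
    rw [← jacobiSum_ringHomComp, ← MulChar.ringHomComp_pow, ← MulChar.ringHomComp_pow,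
      aux_comp p l hp z hz χ hχp _ (t i) (hτ i)]
    have e1 : (χ ^ t i) ^ (p - 1) = χ ^ (p - t i) := by
      rw [← mul_left_inj (χ ^ t i), ← pow_succ, Nat.sub_add_cancel hp.one_le, ← pow_add,
        Nat.sub_add_cancel hti'.le, hχp, ← pow_mul, mul_comm, pow_mul, hχp, one_pow]
    have e2 : (χ ^ t i) ^ (p - k) = χ ^ (p - k * t i % p) := by
      rw [← mul_left_inj ((χ ^ t i) ^ k), ← pow_add, Nat.sub_add_cancel (by omega), ← pow_mul,
        ← pow_mul, mul_comm (t i) k, hmod (k * t i), ← pow_add,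
        Nat.sub_add_cancel hbp.le, hχp, mul_comm, pow_mul, hχp, one_pow]
    rw [e1, e2]
    exact aux_jac_zero p l hp π χ m hm hm0 hχv _ _ (by omega) (by omega) (by omega) (by omega)
      (by omega)

open Polynomial in
lemma aux_coeff (p l : ℕ) (hp : p.Prime) [Fact l.Prime] {E : Type*} [Field E] [Algebra (ZMod l) E]
    (z : E) (hz : z ^ p = 1) (hf : 2 ≤ (minpoly (ZMod l) z).natDegree) :
    (minpoly (ZMod l) z).coeff 0 = (-1) ^ (minpoly (ZMod l) z).natDegree := by
  have hintg : IsIntegral (ZMod l) z := IsIntegral.of_pow hp.pos (by rw [hz]; exact isIntegral_one)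
  have h1 := Algebra.PowerBasis.norm_gen_eq_coeff_zero_minpoly
    (IntermediateField.adjoin.powerBasis hintg)
  rw [IntermediateField.adjoin.powerBasis_gen, IntermediateField.minpoly_gen,
    IntermediateField.adjoin.powerBasis_dim] at h1
  set f := (minpoly (ZMod l) z).natDegree with hfdef
  set N := Algebra.norm (ZMod l) (IntermediateField.AdjoinSimple.gen (ZMod l) z) with hN
  have h2 : N ^ p = 1 := by
    rw [hN, ← map_pow]
    have : (IntermediateField.AdjoinSimple.gen (ZMod l) z) ^ p = 1 := by
      apply Subtype.ext
      push_cast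
      rw [IntermediateField.AdjoinSimple.coe_gen, hz]
    rw [this, map_one]
  have h3 : N = 1 := by
    by_contra hN1
    have : Fact p.Prime := ⟨hp⟩
    have hprim : IsPrimitiveRoot N p := by
      rw [← orderOf_eq_prime h2 hN1]; exact IsPrimitiveRoot.orderOf N
    have hprim' : IsPrimitiveRoot (algebraMap (ZMod l) E N) p :=
      hprim.map_of_injective (algebraMap (ZMod l) E).injective
    have : NeZero p := ⟨hp.ne_zero⟩
    obtain ⟨i, _, hi⟩ := hprim'.eq_pow_of_pow_eq_one hz
    rw [← map_pow] at hi
    rw [hfdef, ← hi, minpoly.eq_X_sub_C, natDegree_X_sub_C] at hf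
    omega
  rw [h3] at h1
  calc (minpoly (ZMod l) z).coeff 0
      = (-1) ^ f * ((-1) ^ f * (minpoly (ZMod l) z).coeff 0) := by
        rw [← mul_assoc, ← mul_pow]; simp
    _ = _ := by rw [← h1, mul_one]

open Polynomial in
lemma aux_aeval {R : Type*} [CommRing R] (l : ℕ) {E : Type*} [Field E]
    [Algebra (ZMod l) E] (π : R →+* E) (z : R) (g : ℤ[X]) :
    π (aeval z g) = aeval (π z) (g.map (Int.castRingHom (ZMod l))) := by
  rw [aeval_def, aeval_def, hom_eval₂, eval₂_map]
  congr 1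
  exact RingHom.ext_int _ _

open Polynomial in
lemma aux_ker_eq {R : Type*} [CommRing R] (z : R) (hz : ∀ x : R, ∃ g : ℤ[X], aeval z g = x)
    (l : ℕ) [Fact l.Prime] {E E' : Type*} [Field E]
    [Algebra (ZMod l) E] [Field E'] [Algebra (ZMod l) E'] (π : R →+* E) (π' : R →+* E')
    (h : minpoly (ZMod l) (π z) = minpoly (ZMod l) (π' z)) : RingHom.ker π = RingHom.ker π' := by
  ext x
  obtain ⟨g, rfl⟩ := hz x
  rw [RingHom.mem_ker, RingHom.mem_ker, aux_aeval l, aux_aeval l, ← minpoly.dvd_iff, h,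
    minpoly.dvd_iff]

open Polynomial in
lemma aux_phi {R : Type*} [CommRing R] (z : R) (hzu : IsUnit z) (p l : ℕ) (hp : p.Prime)
    [hl : Fact l.Prime] {E : Type*} [Field E] [Algebra (ZMod l) E] (π : R →+* E) (Q : Ideal R)
    (hlQ : (l : R) ∉ Q) (hz : π z ^ p = 1) (hf : 2 ≤ (minpoly (ZMod l) (π z)).natDegree) :
    ∃ φ : ℤ[X], φ.Monic ∧ φ.natDegree = (minpoly (ZMod l) (π z)).natDegree ∧
      φ.map (Int.castRingHom (ZMod l)) = minpoly (ZMod l) (π z) ∧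
      φ.coeff 0 = (-1) ^ (minpoly (ZMod l) (π z)).natDegree + l ∧ aeval z φ ∉ Q := by
  have hintg : IsIntegral (ZMod l) (π z) :=
    IsIntegral.of_pow hp.pos (by rw [hz]; exact isIntegral_one)
  have hco := aux_coeff p l hp (π z) hz hf
  obtain ⟨φ0, hmap, hdeg, hmon⟩ := lifts_and_natDegree_eq_and_monic (f := Int.castRingHom (ZMod l))
    (p := minpoly (ZMod l) (π z))
    ((mem_lifts _).2 (map_surjective _ (ZMod.ringHom_surjective _) _)) (minpoly.monic hintg)
  set f := (minpoly (ZMod l) (π z)).natDegree with hfdef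
  have hd : (l : ℤ) ∣ φ0.coeff 0 - (-1) ^ f := by
    rw [← ZMod.intCast_zmod_eq_zero_iff_dvd]
    push_cast
    rw [← hco, ← hmap, coeff_map]
    simp
  obtain ⟨s, hs⟩ := hd
  have key : ∀ r : ℤ, ∃ φ : ℤ[X], φ = φ0 + (C (r * l) * X + C (l - l * s)) ∧ φ.Monic ∧
      φ.natDegree = f ∧
      φ.map (Int.castRingHom (ZMod l)) = minpoly (ZMod l) (π z) ∧
      φ.coeff 0 = (-1) ^ f + l := by
    intro r
    have hdlt : (C (r * l : ℤ) * X + C (l - l * s : ℤ)).degree < φ0.degree := by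
      rw [degree_eq_natDegree hmon.ne_zero, hdeg]
      refine lt_of_le_of_lt degree_linear_le ?_
      exact_mod_cast hf
    refine ⟨_, rfl, hmon.add_of_left hdlt, ?_, ?_, ?_⟩
    · rw [natDegree_add_eq_left_of_degree_lt hdlt, hdeg]
    · rw [Polynomial.map_add, hmap]
      simp
    · simp only [coeff_add, coeff_C_mul, coeff_X_zero, mul_zero, coeff_C_zero]
      linarith
  obtain ⟨φ1, e1, h1⟩ := key 0
  obtain ⟨φ2, e2, h2⟩ := key 1
  by_cases hQ : aeval z φ1 ∈ Q
  · refine ⟨φ2, h2.1, h2.2.1, h2.2.2.1, h2.2.2.2, fun hQ2 => hlQ ?_⟩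
    have h3 : aeval z φ2 - aeval z φ1 = l * z := by
      rw [e1, e2]; simp
    have h4 := Q.sub_mem hQ2 hQ
    rw [h3] at h4
    obtain ⟨u, rfl⟩ := hzu
    have h5 := Q.mul_mem_right (↑u⁻¹ : R) h4
    rwa [mul_assoc, Units.mul_inv, mul_one] at h5
  · exact ⟨φ1, h1.1, h1.2.1, h1.2.2.1, h1.2.2.2, hQ⟩

lemma aux_unram {K : Type*} [Field K] [NumberField K] (p l : ℕ) (hp : p.Prime)
    [IsCyclotomicExtension {p} ℚ K] [hl : Fact l.Prime] (hlp : l ≠ p) (Q : Ideal (𝓞 K))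
    [hQ : Q.IsPrime] (hlQ : (l : 𝓞 K) ∈ Q) : (l : 𝓞 K) ∉ Q ^ 2 := by
  intro h2
  have : NeZero p := ⟨hp.ne_zero⟩
  have hmax : (Ideal.span {(l : ℤ)}).IsMaximal := by
    have : Prime (l : ℤ) := Nat.prime_iff_prime_int.1 hl.out
    exact PrincipalIdealRing.isMaximal_of_irreducible this.irreducible
  have hover : Q.LiesOver (Ideal.span {(l : ℤ)}) := by
    constructor
    refine hmax.eq_of_le (Ideal.IsPrime.under ℤ Q).ne_top ?_
    rw [Ideal.span_singleton_le_iff_mem, Ideal.mem_comap]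
    simpa using hlQ
  have h1 := IsCyclotomicExtension.Rat.ramificationIdx_eq_of_not_dvd (m := p) l K Q
    (fun h => hlp ((Nat.prime_dvd_prime_iff_eq hl.out hp).1 h))
  have hmap : Ideal.map (algebraMap ℤ (𝓞 K)) (Ideal.span {(l : ℤ)}) = Ideal.span {(l : 𝓞 K)} := by
    rw [Ideal.map_span]; simp
  have hb : Ideal.span {(l : 𝓞 K)} ≠ ⊥ := by
    rw [Ne, Ideal.span_singleton_eq_bot]
    exact_mod_cast hl.out.ne_zero
  rw [Ideal.IsDedekindDomain.ramificationIdx_eq_multiplicity (Ideal.span {(l : ℤ)}) Q (by rw [hmap]; exact hb), hmap] at h1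
  have hfin : FiniteMultiplicity Q (Ideal.span {(l : 𝓞 K)}) :=
    FiniteMultiplicity.of_not_isUnit (by rw [Ideal.isUnit_iff]; exact hQ.ne_top) hb
  have := hfin.le_multiplicity_of_pow_dvd (Ideal.dvd_span_singleton.2 h2)
  omega

open Polynomial in
lemma aux_induct {K : Type*} [Field K] [NumberField K] (p : ℕ) [NeZero p] (hp : p.Prime)
    [IsCyclotomicExtension {p} ℚ K] (ζ : K) (hζ : IsPrimitiveRoot ζ p)
    {M : Type*} [CommGroup M] (Θ : ClassGroup (𝓞 K) →* M)
    (H : ∀ (l : ℕ) [Fact l.Prime] (π : 𝓞 K →+* ZMod l), IsPrimitiveRoot (π hζ.toInteger) p →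
      ∀ Q : (Ideal (𝓞 K))⁰, (Q : Ideal (𝓞 K)) = RingHom.ker π → Θ (ClassGroup.mk0 Q) = 1) :
    ∀ c, Θ c = 1 := by
  classical
  have hpf : Fact p.Prime := ⟨hp⟩
  set z := hζ.toInteger with hzdef
  have hz : IsPrimitiveRoot z p := hζ.toInteger_isPrimitiveRoot
  have hgen : ∀ x : 𝓞 K, ∃ g : ℤ[X], aeval z g = x := by
    intro x
    have h1 := IsCyclotomicExtension.Rat.adjoin_singleton_eq_top hζ
    have h2 : x ∈ (⊤ : Subalgebra ℤ (𝓞 K)) := trivial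
    rw [← h1, Algebra.adjoin_singleton_eq_range_aeval] at h2
    exact h2
  -- from primes to all ideals
  have hprod : ∀ I : Ideal (𝓞 K), ∀ hI : I ∈ (Ideal (𝓞 K))⁰,
      (∀ Q : (Ideal (𝓞 K))⁰, (Q : Ideal (𝓞 K)).IsPrime → (Q : Ideal (𝓞 K)) ∣ I →
        Θ (ClassGroup.mk0 Q) = 1) → Θ (ClassGroup.mk0 ⟨I, hI⟩) = 1 := by
    intro I
    induction I using UniqueFactorizationMonoid.induction_on_prime with
    | h₁ => intro hI; exact absurd rfl (nonZeroDivisors.ne_zero hI)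
    | h₂ x hx =>
      intro hI _
      have hx1 : x = 1 := by rw [Ideal.one_eq_top]; exact Ideal.isUnit_iff.1 hx
      subst hx1
      have : (⟨1, hI⟩ : (Ideal (𝓞 K))⁰) = 1 := rfl
      rw [this, map_one, map_one]
    | h₃ a q ha hq ih =>
      intro hI h
      have ha' : a ∈ (Ideal (𝓞 K))⁰ := mem_nonZeroDivisors_of_ne_zero ha
      have hq' : q ∈ (Ideal (𝓞 K))⁰ := mem_nonZeroDivisors_of_ne_zero hq.ne_zero
      have : (⟨q * a, hI⟩ : (Ideal (𝓞 K))⁰) = ⟨q, hq'⟩ * ⟨a, ha'⟩ := rfl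
      rw [this, map_mul, map_mul, ih ha' fun Q h1 h2 => h Q h1 (h2.mul_left q),
        h ⟨q, hq'⟩ (Ideal.isPrime_of_prime hq) (Dvd.intro _ rfl), one_mul]
  -- primes, by induction on the degree
  have main : ∀ n : ℕ, ∀ Q : (Ideal (𝓞 K))⁰, ∀ hQ : (Q : Ideal (𝓞 K)).IsPrime,
      ∀ (l : ℕ) [Fact l.Prime] (E : Type _) [Field E] [Algebra (ZMod l) E] (π : 𝓞 K →+* E),
      Function.Surjective π → (Q : Ideal (𝓞 K)) = RingHom.ker π →
      (minpoly (ZMod l) (π z)).natDegree = n → Θ (ClassGroup.mk0 Q) = 1 := by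
    intro n
    induction n using Nat.strong_induction_on with
    | _ n ih =>
    intro Q hQ l hl E _ _ π hπs hker hn
    have hzp : π z ^ p = 1 := by rw [← map_pow, hz.pow_eq_one, map_one]
    have hintg : IsIntegral (ZMod l) (π z) :=
      IsIntegral.of_pow hp.pos (by rw [hzp]; exact isIntegral_one)
    have hlQ : (l : 𝓞 K) ∈ (Q : Ideal (𝓞 K)) := by
      rw [hker, RingHom.mem_ker, map_natCast, ← map_natCast (algebraMap (ZMod l) E),
        ZMod.natCast_self, map_zero]
    have hprin : ∀ x : 𝓞 K, (Q : Ideal (𝓞 K)) = Ideal.span {x} → Θ (ClassGroup.mk0 Q) = 1 := by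
      intro x hx
      have : ClassGroup.mk0 Q = 1 := by
        refine (ClassGroup.mk0_eq_one_iff Q.2).2 ?_
        rw [hx]; exact ⟨⟨x, rfl⟩⟩
      rw [this, map_one]
    by_cases hz1 : π z = 1
    · -- the prime above p
      refine hprin (z - 1) ?_
      have hpr : Prime (z - 1) := hζ.zeta_sub_one_prime'
      have hm : (Ideal.span {z - 1}).IsMaximal :=
        Ring.DimensionLEOne.maximalOfPrime (by
          rw [Ne, Ideal.span_singleton_eq_bot]; exact hpr.ne_zero)
          ((Ideal.span_singleton_prime hpr.ne_zero).2 hpr)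
      refine (hm.eq_of_le hQ.ne_top ?_).symm
      rw [Ideal.span_singleton_le_iff_mem, hker, RingHom.mem_ker, map_sub, map_one, hz1, sub_self]
    have hprim : IsPrimitiveRoot (π z) p := by
      rw [← orderOf_eq_prime hzp hz1]; exact IsPrimitiveRoot.orderOf _
    have hlp : l ≠ p := by
      rintro rfl
      apply hz1
      have : CharP E l := charP_of_injective_algebraMap (algebraMap (ZMod l) E).injective l
      have h1 : (π z - 1) ^ l = 0 := by rw [sub_pow_char, hzp, one_pow, sub_self]
      exact sub_eq_zero.1 (pow_eq_zero_iff hp.ne_zero |>.1 h1)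
    by_cases hf : 2 ≤ (minpoly (ZMod l) (π z)).natDegree
    · -- degree at least two
      have hzu : IsUnit z := hz.isUnit hp.ne_zero
      obtain ⟨φ, hmon, hdeg, hmap, hco, hnot⟩ := aux_phi z hzu p l hp π ((Q : Ideal (𝓞 K)) ^ 2)
        (aux_unram p l hp hlp _ hlQ) hzp hf
      have hφQ : aeval z φ ∈ (Q : Ideal (𝓞 K)) := by
        rw [hker, RingHom.mem_ker, aux_aeval l, hmap, minpoly.aeval]
      have hφ0 : aeval z φ ≠ 0 := by
        intro h0; rw [h0] at hnot; exact hnot (Ideal.zero_mem _)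
      obtain ⟨B, hB⟩ := Ideal.dvd_span_singleton.2 hφQ
      have hB0 : B ∈ (Ideal (𝓞 K))⁰ := by
        refine mem_nonZeroDivisors_of_ne_zero ?_
        rintro rfl
        rw [mul_zero] at hB
        exact hφ0 (Ideal.span_singleton_eq_bot.1 hB)
      have hBone : Θ (ClassGroup.mk0 ⟨B, hB0⟩) = 1 := by
        refine hprod B hB0 ?_
        intro Q' hQ' hQ'B
        have hne : (Q' : Ideal (𝓞 K)) ≠ Q := by
          intro he
          apply hnot
          rw [he] at hQ'B
          rw [← Ideal.dvd_span_singleton, hB, pow_two]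
          exact mul_dvd_mul_left _ hQ'B
        have hφQ' : aeval z φ ∈ (Q' : Ideal (𝓞 K)) := by
          rw [← Ideal.dvd_span_singleton, hB]; exact hQ'B.mul_left _
        have hmaxQ' : (Q' : Ideal (𝓞 K)).IsMaximal :=
          Ring.DimensionLEOne.maximalOfPrime (nonZeroDivisors.coe_ne_zero Q') hQ'
        let _ : Field (𝓞 K ⧸ (Q' : Ideal (𝓞 K))) := Ideal.Quotient.field _
        have hfinQ : Finite (𝓞 K ⧸ (Q' : Ideal (𝓞 K))) :=
          Ideal.finiteQuotientOfFreeOfNeBot _ (nonZeroDivisors.coe_ne_zero Q')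
        obtain ⟨l', hl'⟩ := CharP.exists (𝓞 K ⧸ (Q' : Ideal (𝓞 K)))
        have hl'p : Fact l'.Prime := ⟨CharP.char_is_prime (𝓞 K ⧸ (Q' : Ideal (𝓞 K))) l'⟩
        let _ : Algebra (ZMod l') (𝓞 K ⧸ (Q' : Ideal (𝓞 K))) := ZMod.algebra _ l'
        set π' := Ideal.Quotient.mk (Q' : Ideal (𝓞 K)) with hπ'
        have hker' : (Q' : Ideal (𝓞 K)) = RingHom.ker π' := (Ideal.mk_ker).symm
        refine ih _ ?_ Q' hQ' l' (𝓞 K ⧸ (Q' : Ideal (𝓞 K))) π' Ideal.Quotient.mk_surjective hker' rfl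
        have hzp' : π' z ^ p = 1 := by rw [← map_pow, hz.pow_eq_one, map_one]
        have hintg' : IsIntegral (ZMod l') (π' z) :=
          IsIntegral.of_pow hp.pos (by rw [hzp']; exact isIntegral_one)
        have hdvd : minpoly (ZMod l') (π' z) ∣ φ.map (Int.castRingHom (ZMod l')) := by
          rw [minpoly.dvd_iff, ← aux_aeval l', ← RingHom.mem_ker, ← hker']
          exact hφQ'
        have hmon' : (φ.map (Int.castRingHom (ZMod l'))).Monic := hmon.map _
        have hle := natDegree_le_of_dvd hdvd hmon'.ne_zero
        rw [hmon.natDegree_map, hdeg, hn] at hle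
        refine lt_of_le_of_ne hle fun heq => ?_
        have hpe : φ.map (Int.castRingHom (ZMod l')) = minpoly (ZMod l') (π' z) := by
          refine (eq_of_monic_of_dvd_of_natDegree_le (minpoly.monic hintg') hmon' hdvd ?_)
          rw [hmon.natDegree_map, hdeg, hn, heq]
        have hco' := aux_coeff p l' hp (π' z) hzp' (by omega)
        rw [← hpe, coeff_map, hmon.natDegree_map, hco, hdeg] at hco'
        have hl0 : ((l : ℕ) : ZMod l') = 0 := by simpa using hco'
        rw [ZMod.natCast_eq_zero_iff, Nat.prime_dvd_prime_iff_eq hl'p.out hl.out] at hl0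
        subst hl0
        apply hne
        rw [hker, hker']
        refine aux_ker_eq z hgen l' π' π ?_
        rw [← hpe, hmap]
      have hmul : ClassGroup.mk0 Q * ClassGroup.mk0 ⟨B, hB0⟩ = 1 := by
        rw [← map_mul]
        have hcoe : ((Q * ⟨B, hB0⟩ : (Ideal (𝓞 K))⁰) : Ideal (𝓞 K)) = Ideal.span {aeval z φ} := hB.symm
        generalize (Q * ⟨B, hB0⟩ : (Ideal (𝓞 K))⁰) = P at hcoe
        refine (ClassGroup.mk0_eq_one_iff P.2).2 ?_
        rw [hcoe]
        exact ⟨⟨_, rfl⟩⟩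
      have := congrArg Θ hmul
      rwa [map_mul, hBone, mul_one, map_one] at this
    · -- degree one
      have hd1 : (minpoly (ZMod l) (π z)).natDegree = 1 := by
        have := minpoly.natDegree_pos hintg
        omega
      obtain ⟨y, hy⟩ := minpoly.mem_range_of_degree_eq_one (ZMod l) (π z) (by
        rw [degree_eq_natDegree (minpoly.ne_zero hintg), hd1]; rfl)
      have hsurj : Function.Surjective (algebraMap (ZMod l) E) := by
        intro e
        obtain ⟨x, rfl⟩ := hπs e
        obtain ⟨g, rfl⟩ := hgen x
        refine ⟨aeval y (g.map (Int.castRingHom (ZMod l))), ?_⟩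
        rw [aux_aeval l, ← hy, aeval_algebraMap_apply]
      let e := RingEquiv.ofBijective (algebraMap (ZMod l) E)
        ⟨(algebraMap (ZMod l) E).injective, hsurj⟩
      refine H l ((e.symm : E →+* ZMod l).comp π) ?_ Q ?_
      · exact hprim.map_of_injective (f := e.symm) e.symm.injective
      · rw [hker]
        ext x
        simp [RingHom.mem_ker]
  intro c
  obtain ⟨I, rfl⟩ := ClassGroup.mk0_surjective c
  refine hprod I.1 I.2 ?_
  intro Q hQ _
  have hmaxQ : (Q : Ideal (𝓞 K)).IsMaximal :=
    Ring.DimensionLEOne.maximalOfPrime (nonZeroDivisors.coe_ne_zero Q) hQ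
  let _ : Field (𝓞 K ⧸ (Q : Ideal (𝓞 K))) := Ideal.Quotient.field _
  have hfinQ : Finite (𝓞 K ⧸ (Q : Ideal (𝓞 K))) :=
    Ideal.finiteQuotientOfFreeOfNeBot _ (nonZeroDivisors.coe_ne_zero Q)
  obtain ⟨l, hl⟩ := CharP.exists (𝓞 K ⧸ (Q : Ideal (𝓞 K)))
  have hlp : Fact l.Prime := ⟨CharP.char_is_prime (𝓞 K ⧸ (Q : Ideal (𝓞 K))) l⟩
  let _ : Algebra (ZMod l) (𝓞 K ⧸ (Q : Ideal (𝓞 K))) := ZMod.algebra _ l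
  exact main _ Q hQ l (𝓞 K ⧸ (Q : Ideal (𝓞 K))) (Ideal.Quotient.mk _)
    Ideal.Quotient.mk_surjective (Ideal.mk_ker).symm rfl

lemma aux_range_mul (d e : ℕ) (f : ℕ → ℤ) :
    ∑ n ∈ range (e * d), f n = ∑ i ∈ range d, ∑ j ∈ range e, f (i + j * d) := by
  rw [Finset.sum_comm]
  induction e with
  | zero => simp
  | succ e ih =>
    rw [Nat.succ_mul, Finset.sum_range_add, ih, Finset.sum_range_succ]
    congr 1
    refine Finset.sum_congr rfl fun i _ => ?_
    rw [add_comm]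

/-- the arithmetic part (iii) -/
lemma aux_arith (p : ℕ) (hp : p.Prime) (v : ℕ) (hv : orderOf (v : ZMod p) = p - 1)
    (vn : ℤ → ℕ) (hvz : ∀ n : ℤ, (vn n : ZMod p) = haveI := Fact.mk hp; (v : ZMod p) ^ n)
    (h : ℕ) (hh : h.Prime) (hhp : h ≠ p) (d : ℕ) (hd0 : 0 < d) (hdp : d ∣ p - 1) (ν : ℤ)
    (h1 : (h : ℤ) ∣ ∑ i ∈ Finset.range (p - 1), (vn (-(i : ℤ)) : ℤ) * ν ^ i)
    (h2 : (h : ℤ) ∣ ν ^ d - 1) (hlt : d < p - 1) :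
    (∀ i : ℕ, i < d →
        (p : ℤ) ∣ ∑ j ∈ Finset.range ((p - 1) / d), (vn (-((i : ℤ) + (j : ℤ) * (d : ℤ))) : ℤ))
      ∧
      (h : ℤ) ∣ ∑ i ∈ Finset.range d, ν ^ i *
        ((∑ j ∈ Finset.range ((p - 1) / d), (vn (-((i : ℤ) + (j : ℤ) * (d : ℤ))) : ℤ)) / (p : ℤ)) := by
  have hpf : Fact p.Prime := ⟨hp⟩
  obtain ⟨e, he⟩ := hdp
  have hed : (p - 1) / d = e := by rw [he, Nat.mul_div_cancel_left _ hd0]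
  rw [hed]
  have hp2 := hp.two_le
  have hv0 : (v : ZMod p) ≠ 0 := by
    intro h0
    rw [h0, orderOf_eq_zero] at hv
    · omega
    · rw [isOfFinOrder_iff_pow_eq_one]
      rintro ⟨n, hn, h3⟩
      rw [zero_pow hn.ne'] at h3
      exact zero_ne_one h3
  have hA : ∀ i : ℕ, (p : ℤ) ∣ ∑ j ∈ Finset.range e, (vn (-((i : ℤ) + (j : ℤ) * (d : ℤ))) : ℤ) := by
    intro i
    rw [← ZMod.intCast_zmod_eq_zero_iff_dvd]
    push_cast
    have hw1 : (v : ZMod p) ^ (-(d : ℤ)) ≠ 1 := by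
      rw [zpow_neg, zpow_natCast, Ne, inv_eq_one]
      intro h3
      have := Nat.le_of_dvd hd0 (orderOf_dvd_of_pow_eq_one h3)
      omega
    have hwe : ((v : ZMod p) ^ (-(d : ℤ))) ^ e = 1 := by
      rw [zpow_neg, zpow_natCast, inv_pow, ← pow_mul, ← he, ← hv, pow_orderOf_eq_one, inv_one]
    have hterm : ∀ j ∈ range e, (vn (-((i : ℤ) + (j : ℤ) * (d : ℤ))) : ZMod p) =
        (v : ZMod p) ^ (-(i : ℤ)) * ((v : ZMod p) ^ (-(d : ℤ))) ^ j := by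
      intro j _
      rw [hvz, ← zpow_natCast, ← zpow_mul, ← zpow_add₀ hv0]
      congr 1
      ring
    rw [Finset.sum_congr rfl hterm, ← Finset.mul_sum]
    have := geom_sum_mul ((v : ZMod p) ^ (-(d : ℤ))) e
    rw [hwe, sub_self] at this
    rcases mul_eq_zero.1 this with h3 | h3
    · rw [h3, mul_zero]
    · exact absurd (sub_eq_zero.1 h3) hw1
  refine ⟨fun i _ => hA i, ?_⟩
  have hcop : IsCoprime (h : ℤ) (p : ℤ) := by
    rw [Nat.isCoprime_iff_coprime]
    exact (Nat.coprime_primes hh hp).2 hhp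
  refine hcop.dvd_of_dvd_mul_left ?_
  rw [Finset.mul_sum]
  have hS : ∀ i ∈ range d, (p : ℤ) * (ν ^ i *
        ((∑ j ∈ Finset.range e, (vn (-((i : ℤ) + (j : ℤ) * (d : ℤ))) : ℤ)) / (p : ℤ))) =
      ∑ j ∈ Finset.range e, (vn (-((i : ℤ) + (j : ℤ) * (d : ℤ))) : ℤ) * ν ^ i := by
    intro i _
    rw [mul_left_comm, Int.mul_ediv_cancel' (hA i), ← Finset.sum_mul, mul_comm]
  rw [Finset.sum_congr rfl hS]
  rw [he, mul_comm d e, aux_range_mul] at h1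
  rw [← dvd_sub_right h1, ← Finset.sum_sub_distrib]
  refine Finset.dvd_sum fun i _ => ?_
  rw [← Finset.sum_sub_distrib]
  refine Finset.dvd_sum fun j _ => ?_
  push_cast
  rw [← mul_sub]
  refine Dvd.dvd.mul_left ?_ _
  rw [pow_add, mul_comm j d, pow_mul]
  have h3 : ν ^ i * (ν ^ d) ^ j - ν ^ i = ν ^ i * ((ν ^ d) ^ j - 1) := by ring
  rw [h3]
  refine Dvd.dvd.mul_left (h2.trans ?_) _
  simpa using sub_dvd_pow_sub_pow (ν ^ d) 1 j

theorem statement11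
    (p : ℕ) (hp : p.Prime) (hp2 : p ≠ 2)
    (v : ℕ) (hv1 : 1 ≤ v) (hv2 : v ≤ p - 1)
    (hv : orderOf (v : ZMod p) = p - 1)
    (vn : ℤ → ℕ)
    (hvn1 : ∀ n : ℤ, 1 ≤ vn n) (hvn2 : ∀ n : ℤ, vn n ≤ p - 1)
    (hvn0 : vn 0 = 1)
    (hvnrec : ∀ n : ℤ, (vn (n + 1) : ZMod p) = (v : ZMod p) * (vn n : ZMod p))
    (K : Type*) [Field K] [NumberField K]
    [IsCyclotomicExtension {p} ℚ K]
    (ζ : K) (hζ : IsPrimitiveRoot ζ p)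
    (σ : K ≃ₐ[ℚ] K) (hσ : σ ζ = ζ ^ v)
    (σ' : 𝓞 K ≃+* 𝓞 K)
    (hσ' : ∀ x : 𝓞 K, algebraMap (𝓞 K) K (σ' x) = σ (algebraMap (𝓞 K) K x))
    (T : MulAut (ClassGroup (𝓞 K)))
    (hT : ∀ I J : (Ideal (𝓞 K))⁰,
      Ideal.map σ' (I : Ideal (𝓞 K)) = (J : Ideal (𝓞 K)) →
      T (ClassGroup.mk0 I) = ClassGroup.mk0 J)
    (h : ℕ) (hh : h.Prime) (hhodd : h ≠ 2) (hhp : h ≠ p)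
    (d : ℕ) (hd : d = Nat.gcd (h - 1) (p - 1))
    (c : ClassGroup (𝓞 K)) (hc : orderOf c = h)
    (ν : ℤ) (hTc : T c = c ^ ν) :
    ((h : ℤ) ∣ ∑ i ∈ Finset.range (p - 1), (vn (-(i : ℤ)) : ℤ) * ν ^ i)
    ∧
    ((h : ℤ) ∣ ν ^ d - 1)
    ∧
    (d < p - 1 →
      (∀ i : ℕ, i < d →
        (p : ℤ) ∣ ∑ j ∈ Finset.range ((p - 1) / d), (vn (-((i : ℤ) + (j : ℤ) * (d : ℤ))) : ℤ))
      ∧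
      (h : ℤ) ∣ ∑ i ∈ Finset.range d, ν ^ i *
        ((∑ j ∈ Finset.range ((p - 1) / d), (vn (-((i : ℤ) + (j : ℤ) * (d : ℤ))) : ℤ)) / (p : ℤ))) := by
  have hpf : Fact p.Prime := ⟨hp⟩
  have hpz : NeZero p := ⟨hp.ne_zero⟩
  have hp2' := hp.two_le
  have hv0 : (v : ZMod p) ≠ 0 := by
    rw [Ne, ZMod.natCast_eq_zero_iff]
    intro h0
    have := Nat.le_of_dvd hv1 h0
    omega
  have hvz : ∀ n : ℤ, (vn n : ZMod p) = (v : ZMod p) ^ n := by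
    intro n
    induction n using Int.induction_on with
    | zero => simp [hvn0]
    | succ n ih => rw [hvnrec, ih, zpow_add_one₀ hv0, mul_comm]
    | pred n ih =>
      have h1 := hvnrec (-(n : ℤ) - 1)
      rw [sub_add_cancel, ih] at h1
      rw [zpow_sub_one₀ hv0, h1, mul_comm (v : ZMod p), mul_assoc, mul_inv_cancel₀ hv0, mul_one]
  set z := hζ.toInteger with hzdef
  have hz : IsPrimitiveRoot z p := hζ.toInteger_isPrimitiveRoot
  have hσz : σ' z = z ^ v := by
    apply RingOfIntegers.coe_injective
    rw [hσ', map_pow]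
    exact hσ
  have hσzi : ∀ i : ℕ, (σ' ^ i : RingAut (𝓞 K)) z = z ^ (v ^ i) := by
    intro i
    induction i with
    | zero => simp
    | succ i ih => rw [pow_succ', RingAut.mul_apply, ih, map_pow, hσz, ← pow_mul, pow_succ']
  have hzmod : ∀ a b : ℕ, (a : ZMod p) = b → z ^ a = z ^ b := by
    intro a b hab
    rw [ZMod.natCast_eq_natCast_iff] at hab
    have hab1 : a % p = b % p := hab
    rw [← pow_mod_orderOf z a, ← pow_mod_orderOf z b, ← hz.eq_orderOf, hab1]
  have hsymm : ∀ i : ℕ, (σ' ^ i : RingAut (𝓞 K)).symm z = z ^ vn (-(i : ℤ)) := by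
    intro i
    rw [RingEquiv.symm_apply_eq, map_pow, hσzi, ← pow_mul]
    conv_lhs => rw [← pow_one z]
    apply hzmod
    push_cast
    rw [hvz, zpow_neg, zpow_natCast, mul_inv_cancel₀ (pow_ne_zero _ hv0)]
  have hgen : ∀ x : 𝓞 K, ∃ g : Polynomial ℤ, Polynomial.aeval z g = x := by
    intro x
    have h1 := IsCyclotomicExtension.Rat.adjoin_singleton_eq_top hζ
    have h2 : x ∈ (⊤ : Subalgebra ℤ (𝓞 K)) := trivial
    rw [← h1, Algebra.adjoin_singleton_eq_range_aeval] at h2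
    exact h2
  have hσone : (σ' ^ (p - 1) : RingAut (𝓞 K)) = 1 := by
    ext1 x
    obtain ⟨g, rfl⟩ := hgen x
    have h1 : (σ' ^ (p - 1) : RingAut (𝓞 K)) z = z := by
      rw [hσzi]
      conv_rhs => rw [← pow_one z]
      apply hzmod
      push_cast
      rw [← hv, pow_orderOf_eq_one]
    have h2 := Polynomial.aeval_algHom_apply
      ((σ' ^ (p - 1) : RingAut (𝓞 K)) : 𝓞 K →+* 𝓞 K).toIntAlgHom z g
    change Polynomial.aeval ((σ' ^ (p - 1) : RingAut (𝓞 K)) z) g =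
      (σ' ^ (p - 1) : RingAut (𝓞 K)) (Polynomial.aeval z g) at h2
    rw [← h2, h1]
    rfl
  have hTi : ∀ (i : ℕ) (Q : (Ideal (𝓞 K))⁰), ∃ Q' : (Ideal (𝓞 K))⁰,
      (∀ x, x ∈ (Q' : Ideal (𝓞 K)) ↔ (σ' ^ i : RingAut (𝓞 K)).symm x ∈ (Q : Ideal (𝓞 K))) ∧
      (T ^ i) (ClassGroup.mk0 Q) = ClassGroup.mk0 Q' := by
    intro i Q
    induction i with
    | zero => exact ⟨Q, fun x => Iff.rfl, by simp⟩
    | succ i ih =>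
      obtain ⟨Q', h1, h2⟩ := ih
      have hne : Ideal.map σ' (Q' : Ideal (𝓞 K)) ≠ ⊥ := by
        intro hb
        apply nonZeroDivisors.coe_ne_zero Q'
        exact (Ideal.map_eq_bot_iff_of_injective σ'.injective).1 hb
      refine ⟨⟨Ideal.map σ' (Q' : Ideal (𝓞 K)), mem_nonZeroDivisors_of_ne_zero hne⟩, ?_, ?_⟩
      · intro x
        change x ∈ Ideal.map σ' (Q' : Ideal (𝓞 K)) ↔ _
        have h3 : x ∈ Ideal.map σ' (Q' : Ideal (𝓞 K)) ↔ σ'.symm x ∈ (Q' : Ideal (𝓞 K)) := by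
          have h4 : Ideal.comap σ'.symm (Q' : Ideal (𝓞 K)) = Ideal.map σ' (Q' : Ideal (𝓞 K)) :=
            Ideal.comap_symm σ'
          rw [← h4]; rfl
        rw [h3, h1]
        have h5 : (σ' ^ i : RingAut (𝓞 K)).symm (σ'.symm x) =
            (σ' ^ (i + 1) : RingAut (𝓞 K)).symm x := by
          rw [pow_succ']; rfl
        rw [h5]
      · rw [pow_succ', MulAut.mul_apply, h2]
        exact hT _ _ rfl
  have hfr : Module.finrank ℤ (𝓞 K) = p - 1 := by
    rw [RingOfIntegers.rank, IsCyclotomicExtension.finrank (n := p) K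
      (Polynomial.cyclotomic.irreducible_rat hp.pos), Nat.totient_prime hp]
  -- Stickelberger
  have hst : ∀ c : ClassGroup (𝓞 K),
      ∏ i ∈ range (p - 1), ((T ^ i) c) ^ vn (-(i : ℤ)) = 1 := by
    let Θ : ClassGroup (𝓞 K) →* ClassGroup (𝓞 K) :=
      ∏ i ∈ range (p - 1), ((T ^ i).toMonoidHom) ^ vn (-(i : ℤ))
    have hΘ : ∀ c, Θ c = ∏ i ∈ range (p - 1), ((T ^ i) c) ^ vn (-(i : ℤ)) := by
      intro c
      simp only [Θ, MonoidHom.finsetProd_apply, MonoidHom.pow_apply]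
      rfl
    intro c
    rw [← hΘ]
    refine aux_induct p hp ζ hζ Θ ?_ c
    intro l hl π hπ Q hQ
    rw [hΘ]
    choose q hq1 hq2 using fun i => hTi i Q
    rw [Finset.prod_congr rfl fun i _ => by rw [hq2 i]]
    refine aux_deg_one p l hp hfr z hz π hπ (fun i => (σ' ^ i : RingAut (𝓞 K)))
      (fun i => vn (-(i : ℤ))) (fun i => hvn1 _) (fun i => ?_) hsymm ?_ q ?_
    · have := hvn2 (-(i : ℤ))
      show vn (-(i : ℤ)) < p
      omega
    · intro i hi j hj hij
      have h1 : (v : ZMod p) ^ (-(i : ℤ)) = (v : ZMod p) ^ (-(j : ℤ)) := by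
        rw [← hvz, ← hvz]; exact congrArg _ hij
      rw [zpow_neg, zpow_neg, inv_inj, zpow_natCast, zpow_natCast] at h1
      exact pow_injOn_Iio_orderOf (by rw [hv]; exact hi) (by rw [hv]; exact hj) h1
    · intro i
      ext x
      rw [hq1, hQ, RingHom.mem_ker, RingHom.mem_ker]
      rfl
  have hTc' : ∀ i : ℕ, (T ^ i) c = c ^ (ν ^ i) := by
    intro i
    induction i with
    | zero => simp
    | succ i ih => rw [pow_succ', MulAut.mul_apply, ih, map_zpow, hTc, ← zpow_mul, pow_succ']
  have hdvd : ∀ n : ℤ, c ^ n = 1 → (h : ℤ) ∣ n := by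
    intro n hn
    rw [← hc]; exact orderOf_dvd_iff_zpow_eq_one.2 hn
  have h1 : (h : ℤ) ∣ ∑ i ∈ Finset.range (p - 1), (vn (-(i : ℤ)) : ℤ) * ν ^ i := by
    apply hdvd
    have h2 := hst c
    have h3 : ∀ s : Finset ℕ, c ^ (∑ i ∈ s, (vn (-(i : ℤ)) : ℤ) * ν ^ i) =
        ∏ i ∈ s, ((T ^ i) c) ^ vn (-(i : ℤ)) := by
      intro s
      induction s using Finset.induction_on with
      | empty => simp
      | insert a s ha ih =>
        rw [Finset.sum_insert ha, Finset.prod_insert ha, zpow_add, ih, hTc', ← zpow_natCast,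
          ← zpow_mul, mul_comm (ν ^ a)]
    rw [h3, h2]
  have h2 : (h : ℤ) ∣ ν ^ d - 1 := by
    have hT1 : (T ^ (p - 1)) c = c := by
      obtain ⟨Q, rfl⟩ := ClassGroup.mk0_surjective c
      obtain ⟨Q', h3, h4⟩ := hTi (p - 1) Q
      rw [h4]
      congr 1
      ext x
      rw [h3, hσone]
      rfl
    have h3 : (h : ℤ) ∣ ν ^ (p - 1) - 1 := by
      apply hdvd
      rw [zpow_sub, ← hTc', hT1, zpow_one, mul_inv_cancel]
    have hhf : Fact h.Prime := ⟨hh⟩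
    have h4 : (ν : ZMod h) ^ (p - 1) = 1 := by
      rw [← ZMod.intCast_zmod_eq_zero_iff_dvd] at h3
      push_cast at h3
      exact sub_eq_zero.1 h3
    have hν0 : (ν : ZMod h) ≠ 0 := by
      intro h0
      rw [h0, zero_pow (by omega)] at h4
      exact zero_ne_one h4
    have h5 : (ν : ZMod h) ^ (h - 1) = 1 := ZMod.pow_card_sub_one_eq_one hν0
    have h6 : (ν : ZMod h) ^ d = 1 := by
      rw [hd]
      exact pow_gcd_eq_one.2 ⟨h5, h4⟩
    rw [← ZMod.intCast_zmod_eq_zero_iff_dvd]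
    push_cast
    rw [h6, sub_self]
  refine ⟨h1, h2, fun hlt => ?_⟩
  have hd0 : 0 < d := by
    rw [hd]; exact Nat.gcd_pos_of_pos_right _ (by omega)
  exact aux_arith p hp v hv vn hvz h hh hhp d hd0 (by rw [hd]; exact Nat.gcd_dvd_right _ _) ν h1 h2
    hlt
end

section
/- Let h be an odd prime with h ≠ p. Let c be a nontrivial ideal class of O_K with c^h = 1 and σ^{(p−1)/2}(c) = c^{-1}. For a polynomial W = Σ_i w_i X^i ∈ 𝔽_h[X], say that W annihilates c if ∏_i (σ^i(c))^{ŵ_i} = 1, where ŵ_i ∈ {0,…,h−1} is the integer lift of w_i. Then every monic polynomial V ∈ 𝔽_h[X] of minimal degree among the monic polynomials annihilating c divides both P(X) mod h and X^{(p−1)/2} + 1 in 𝔽_h[X]; in particular V divides D(X) = gcd(P(X) mod h, X^{(p−1)/2} + 1). -/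
open NumberField Finset nonZeroDivisors Polynomial

/-- The endomorphism of the additive class group attached to `T`. -/
noncomputable def auxEnd {M : Type*} [CommGroup M] (T : MulAut M) : Module.End ℤ (Additive M) :=
  (MonoidHom.toAdditive T.toMonoidHom).toIntLinearMap

lemma auxEnd_pow {M : Type*} [CommGroup M] (T : MulAut M) (i : ℕ) (c : M) :
    ((auxEnd T) ^ i) (Additive.ofMul c) = Additive.ofMul ((T ^ i) c) := by
  induction i with
  | zero => simp
  | succ i ih =>
    rw [pow_succ', pow_succ', Module.End.mul_apply, ih]
    rfl

lemma aux_aeval_s12 {M : Type*} [CommGroup M] (T : MulAut M) (G : ℤ[X]) (c : M) :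
    (aeval (auxEnd T) G) (Additive.ofMul c) =
      ∑ i ∈ G.support, G.coeff i • Additive.ofMul ((T ^ i) c) := by
  rw [aeval_def, eval₂_eq_sum, Polynomial.sum_def, LinearMap.sum_apply]
  refine Finset.sum_congr rfl fun i _ => ?_
  rw [Module.End.mul_apply, auxEnd_pow]
  simp

lemma aux_wd {M : Type*} [CommGroup M] (T : MulAut M) (h : ℕ)
    (c : M) (hch : c ^ h = 1) (G G' : ℤ[X])
    (hG : G.map (Int.castRingHom (ZMod h)) = G'.map (Int.castRingHom (ZMod h))) :
    (aeval (auxEnd T) G) (Additive.ofMul c) = (aeval (auxEnd T) G') (Additive.ofMul c) := by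
  have h1 : (C (h : ℤ)) ∣ G - G' := by
    rw [Polynomial.C_dvd_iff_dvd_coeff]
    intro i
    have := congrArg (fun f => f.coeff i) hG
    simp only [coeff_map, eq_intCast] at this
    rw [coeff_sub]
    have h2 := (ZMod.intCast_eq_intCast_iff_dvd_sub _ _ h).1 this
    exact (dvd_sub_comm).1 h2
  obtain ⟨H, hH⟩ := h1
  have : G = G' + H * C (h : ℤ) := by rw [mul_comm, ← hH]; ring
  rw [this, map_add, map_mul, LinearMap.add_apply, Module.End.mul_apply]
  have : (aeval (auxEnd T) (C (h : ℤ))) (Additive.ofMul c) = 0 := by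
    rw [aeval_C]
    simp [Module.algebraMap_end_apply, ← ofMul_pow, hch]
  rw [this]; simp

/-- integer lift -/
noncomputable def auxLift {h : ℕ} (W : (ZMod h)[X]) : ℤ[X] :=
  ∑ i ∈ W.support, C ((W.coeff i).val : ℤ) * X ^ i

lemma auxLift_map {h : ℕ} [NeZero h] (W : (ZMod h)[X]) :
    (auxLift W).map (Int.castRingHom (ZMod h)) = W := by
  conv_rhs => rw [W.as_sum_support_C_mul_X_pow]
  rw [auxLift, Polynomial.map_sum]
  refine Finset.sum_congr rfl fun i _ => ?_
  rw [Polynomial.map_mul, Polynomial.map_C, Polynomial.map_pow, Polynomial.map_X, eq_intCast,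
    Int.cast_natCast, ZMod.natCast_zmod_val]

lemma auxLift_eval {h : ℕ} {M : Type*} [CommGroup M] (T : MulAut M) (c : M) (W : (ZMod h)[X]) :
    (aeval (auxEnd T) (auxLift W)) (Additive.ofMul c) =
      Additive.ofMul (∏ i ∈ W.support, ((T ^ i) c) ^ (W.coeff i).val) := by
  simp only [auxLift, map_sum, LinearMap.sum_apply, ofMul_prod, map_mul, map_pow, aeval_X,
    Module.End.mul_apply, auxEnd_pow, aeval_C]
  simp [Module.algebraMap_end_apply]

lemma aux_ann {M : Type*} [CommGroup M] (T : MulAut M) (h : ℕ) [Fact h.Prime]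
    (c : M) (hch : c ^ h = 1) (V : (ZMod h)[X]) (hV : V.Monic)
    (hVa : ∏ i ∈ V.support, ((T ^ i) c) ^ (V.coeff i).val = 1)
    (hmin : ∀ W : Polynomial (ZMod h), W.Monic →
        (∏ i ∈ W.support, ((T ^ i) c) ^ (W.coeff i).val = 1) → V.degree ≤ W.degree)
    (G : ℤ[X]) (hG : (aeval (auxEnd T) G) (Additive.ofMul c) = 0) :
    V ∣ G.map (Int.castRingHom (ZMod h)) := by
  set W := G.map (Int.castRingHom (ZMod h)) with hW
  rw [← modByMonic_eq_zero_iff_dvd hV]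
  by_contra hR
  set R := W %ₘ V with hRdef
  have hdeg : R.degree < V.degree := degree_modByMonic_lt _ hV
  have hu : R.leadingCoeff ≠ 0 := leadingCoeff_ne_zero.2 hR
  have hm : (R * C (R.leadingCoeff⁻¹)).Monic := monic_mul_leadingCoeff_inv hR
  have hval : (aeval (auxEnd T) (auxLift V)) (Additive.ofMul c) = 0 := by
    rw [auxLift_eval, hVa]; rfl
  have key := hmin _ hm (by
    rw [← ofMul_eq_zero, ← auxLift_eval]
    have := aux_wd T h c hch (auxLift (R * C (R.leadingCoeff⁻¹)))
      (auxLift (C (R.leadingCoeff⁻¹)) * (G - auxLift (W /ₘ V) * auxLift V)) (by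
        rw [Polynomial.map_mul, Polynomial.map_sub, Polynomial.map_mul]
        simp only [auxLift_map]
        rw [← hW, hRdef, modByMonic_eq_sub_mul_div W V]
        ring)
    rw [this, map_mul, map_sub, map_mul, Module.End.mul_apply, LinearMap.sub_apply,
      Module.End.mul_apply, hG, hval]
    simp)
  rw [degree_mul_leadingCoeff_inv _ hR] at key
  exact absurd hdeg (not_lt.2 key)

lemma aux_charP {R : Type*} [CommRing R] [Nontrivial R] {l : ℕ} (hl : l.Prime) (h : (l : R) = 0) :
    CharP R l := by
  have h1 : ringChar R ∣ l := ringChar.dvd h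
  rcases (Nat.dvd_prime hl).1 h1 with h2 | h2
  · exact absurd h2 CharP.ringChar_ne_one
  · exact ringChar.of_eq h2

lemma aux_map_minpoly {k : Type*} [Field k] {l : ℕ} [Fact l.Prime] [CharP k l] [Algebra (ZMod l) k]
    {w : k} {g : ℤ[X]} (hg : g.Monic) (hgw : aeval w g = 0)
    (hmin : ∀ g' : ℤ[X], g'.Monic → aeval w g' = 0 → g.natDegree ≤ g'.natDegree) :
    g.map (Int.castRingHom (ZMod l)) = minpoly (ZMod l) w := by
  have hev : ∀ f : ℤ[X], aeval w (f.map (Int.castRingHom (ZMod l))) = aeval w f := by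
    intro f
    rw [aeval_def, eval₂_map, aeval_def]
    congr 1
    exact RingHom.ext_int _ _
  refine minpoly.unique _ _ (hg.map _) (by rw [hev, hgw]) fun q hq hqw => ?_
  obtain ⟨q', h1, h2, h3⟩ := lifts_and_natDegree_eq_and_monic (f := Int.castRingHom (ZMod l)) (p := q)
    (by
      rw [lifts_iff_coeff_lifts]
      intro n
      exact ZMod.intCast_surjective _) hq
  have := hmin q' h3 (by rw [← hev, h1, hqw])
  rw [h2] at this
  rw [degree_eq_natDegree hq.ne_zero, degree_eq_natDegree (hg.map _).ne_zero, hg.natDegree_map]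
  exact_mod_cast this

lemma aux_const {k : Type*} [Field k] {l p : ℕ} (hl : l.Prime) (hp : p.Prime) (hk : (l : k) = 0)
    {w : k} (hw : w ^ p = 1) {g : ℤ[X]} (hg : g.Monic) (hgw : aeval w g = 0)
    (hmin : ∀ g' : ℤ[X], g'.Monic → aeval w g' = 0 → g.natDegree ≤ g'.natDegree)
    (h2 : 2 ≤ g.natDegree) :
    ((g.coeff 0 : ℤ) : k) = (-1) ^ g.natDegree := by
  haveI := Fact.mk hl
  haveI : CharP k l := aux_charP hl hk
  letI : Algebra (ZMod l) k := ZMod.algebra k l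
  have hm := aux_map_minpoly (l := l) hg hgw hmin
  have hIntw : IsIntegral (ZMod l) w := by
    refine ⟨X ^ p - 1, monic_X_pow_sub_C 1 hp.ne_zero, by simp [hw]⟩
  have hnp : ¬ p ∣ l - 1 := by
    intro hd
    have h3 : w ^ l = w := by
      obtain ⟨e, he⟩ := hd
      have : l = p * e + 1 := by have := hl.pos; omega
      rw [this, pow_succ, pow_mul, hw]; simp
    rw [← Subfield.mem_bot_iff_pow_eq_self, mem_bot_iff_intCast l] at h3
    obtain ⟨t, ht⟩ := h3
    have := hmin (X - C t) (monic_X_sub_C t) (by simp [ht])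
    rw [natDegree_X_sub_C] at this
    omega
  have hN := Algebra.PowerBasis.norm_gen_eq_coeff_zero_minpoly
    (IntermediateField.adjoin.powerBasis hIntw)
  rw [IntermediateField.adjoin.powerBasis_gen, IntermediateField.minpoly_gen, ← hm,
    IntermediateField.adjoin.powerBasis_dim, ← hm, hg.natDegree_map, coeff_map, eq_intCast] at hN
  set y : ZMod l := (Algebra.norm (ZMod l)) (IntermediateField.AdjoinSimple.gen (ZMod l) w) with hy
  have hyp : y ^ p = 1 := by
    rw [hy, ← map_pow]
    have : (IntermediateField.AdjoinSimple.gen (ZMod l) w) ^ p = 1 := by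
      apply Subtype.ext
      simp [hw]
    rw [this, map_one]
  have hy0 : y ≠ 0 := by
    rintro h0
    rw [h0, zero_pow hp.ne_zero] at hyp
    exact zero_ne_one hyp
  have hyl : y ^ (l - 1) = 1 := ZMod.pow_card_sub_one_eq_one hy0
  have hy1 : y = 1 := by
    have h4 : orderOf y ∣ Nat.gcd p (l - 1) :=
      Nat.dvd_gcd (orderOf_dvd_of_pow_eq_one hyp) (orderOf_dvd_of_pow_eq_one hyl)
    rw [(Nat.Prime.coprime_iff_not_dvd hp).2 hnp, Nat.dvd_one, orderOf_eq_one_iff] at h4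
    exact h4
  rw [hy1] at hN
  have h5 := congrArg (algebraMap (ZMod l) k) hN
  simp only [map_one, map_mul, map_pow, map_neg, map_intCast] at h5
  have h6 : ((-1 : k) ^ g.natDegree) * (-1) ^ g.natDegree = 1 := by
    rw [← mul_pow]; simp
  calc ((g.coeff 0 : ℤ) : k) = ((-1 : k) ^ g.natDegree * (-1) ^ g.natDegree) * (g.coeff 0 : ℤ) := by
        rw [h6, one_mul]
    _ = (-1 : k) ^ g.natDegree * ((-1) ^ g.natDegree * (g.coeff 0 : ℤ)) := by ring
    _ = _ := by rw [← h5, mul_one]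

lemma aux_frob {R : Type*} [CommRing R] {z : R} {p : ℕ} (hp : p.Prime)
    (hz : z ^ p = 1) (hgen : ∀ x : R, ∃ a : ℤ[X], aeval z a = x)
    {l : ℕ} (hl : l.Prime) (hlp : l ≠ p) (I : Ideal R) (hI : I ≠ ⊤) (hlI : (l : R) ∈ I) (x : R) :
    x ^ (l ^ (p - 1)) - x ∈ I := by
  haveI : Nontrivial (R ⧸ I) := Ideal.Quotient.nontrivial_iff.2 hI
  have h0 : ((l : ℕ) : R ⧸ I) = 0 := by
    rw [← map_natCast (Ideal.Quotient.mk I), Ideal.Quotient.eq_zero_iff_mem]; exact hlI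
  haveI := Fact.mk hl
  haveI : CharP (R ⧸ I) l := aux_charP hl h0
  obtain ⟨a, rfl⟩ := hgen x
  have hz' : z ^ (l ^ (p - 1)) = z := by
    have h1 : l ^ (p - 1) ≡ 1 [MOD p] := by
      rw [← Nat.totient_prime hp]
      exact Nat.ModEq.pow_totient ((Nat.coprime_primes hl hp).2 hlp)
    have h2 : 1 ≤ l ^ (p - 1) := Nat.one_le_pow _ _ hl.pos
    obtain ⟨e, he⟩ := (Nat.modEq_iff_dvd' h2).1 h1.symm
    have : l ^ (p - 1) = p * e + 1 := by omega
    rw [this, pow_succ, pow_mul, hz]; simp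
  rw [← Ideal.Quotient.eq_zero_iff_mem, map_sub, map_pow, sub_eq_zero]
  set w := Ideal.Quotient.mk I z
  have e1 : Ideal.Quotient.mk I (aeval z a) = aeval w a := by
    rw [aeval_def, hom_eval₂, aeval_def]
    congr 1
  rw [e1]
  have hw : iterateFrobenius (R ⧸ I) l (p - 1) w = w := by
    rw [iterateFrobenius_def, ← map_pow, hz']
  change iterateFrobenius (R ⧸ I) l (p - 1) (aeval w a) = aeval w a
  rw [aeval_def, hom_eval₂, hw]
  congr 1
  exact RingHom.ext_int _ _

lemma aux_unram_s12 {R : Type*} [CommRing R] [IsDedekindDomain R] {z : R} {p : ℕ} (hp : p.Prime)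
    (hz : z ^ p = 1) (hgen : ∀ x : R, ∃ a : ℤ[X], aeval z a = x)
    {l : ℕ} (hl : l.Prime) (hlp : l ≠ p) (Q : Ideal R) [hQ : Q.IsPrime] (hQ0 : Q ≠ ⊥) :
    (l : R) ∉ Q ^ 2 := by
  intro h
  have hlt : Q ^ 2 < Q := by
    simpa using Ideal.pow_right_strictAnti Q hQ0 hQ.ne_top (show 1 < 2 by norm_num)
  refine absurd (fun x hx => ?_) hlt.not_ge
  have h1 := aux_frob hp hz hgen hl hlp (Q ^ 2) (fun h => hQ.ne_top (top_le_iff.1 (h ▸ hlt.le))) h x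
  have h2 : x ^ (l ^ (p - 1)) ∈ Q ^ 2 := by
    refine Ideal.pow_le_pow_right ?_ (Ideal.pow_mem_pow hx (l ^ (p - 1)))
    calc 2 ≤ l := hl.two_le
      _ ≤ l ^ (p - 1) := Nat.le_self_pow (by have := hp.two_le; omega) l
  have := (Q ^ 2).sub_mem h2 h1
  simpa using this

lemma aux_exists_prime {R : Type*} [CommRing R] [IsDedekindDomain R] [Module.Free ℤ R]
    [Module.Finite ℤ R] (Q : Ideal R) [hQ : Q.IsPrime] (hQ0 : Q ≠ ⊥) :
    ∃ l : ℕ, l.Prime ∧ (l : R) ∈ Q := by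
  haveI := Ideal.finiteQuotientOfFreeOfNeBot Q hQ0
  haveI : Fintype (R ⧸ Q) := Fintype.ofFinite _
  obtain ⟨l, hl⟩ := CharP.exists (R ⧸ Q)
  refine ⟨l, ?_, ?_⟩
  · rcases CharP.char_is_prime_or_zero (R ⧸ Q) l with h | h
    · exact h
    · subst h
      haveI := CharP.charP_to_charZero (R ⧸ Q)
      exact absurd ‹Finite (R ⧸ Q)› (not_finite_iff_infinite.2 (Infinite.of_injective _ (Nat.cast_injective (R := R ⧸ Q))))
  · rw [← Ideal.Quotient.eq_zero_iff_mem, map_natCast]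
    exact CharP.cast_eq_zero _ _

lemma aux_hev {R k : Type*} [CommRing R] [CommRing k] (φ : R →+* k) (z : R) (f : ℤ[X]) :
    φ (aeval z f) = aeval (φ z) f := by
  rw [aeval_def, hom_eval₂, aeval_def]
  congr 1
  exact RingHom.ext_int _ _

lemma aux_const2 {R k : Type*} [CommRing R] [Field k] (φ : R →+* k) (P : Ideal R)
    (hφ : ∀ x, φ x = 0 ↔ x ∈ P) {z : R} {l p n : ℕ} (hl : l.Prime) (hp : p.Prime)
    (hlP : (l : R) ∈ P) (hz : z ^ p = 1) {f : ℤ[X]} (hf : f.Monic) (hfn : f.natDegree = n)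
    (h2 : 2 ≤ n) (hfP : aeval z f ∈ P)
    (hmin : ∀ g' : ℤ[X], g'.Monic → g'.natDegree < n → aeval z g' ∉ P) :
    ((f.coeff 0 - (-1) ^ n : ℤ) : R) ∈ P := by
  have := aux_const (k := k) (w := φ z) (g := f) hl hp
      (by rw [← map_natCast φ, hφ]; exact hlP)
      (by rw [← map_pow, hz, map_one]) hf
      (by rw [← aux_hev, hφ]; exact hfP)
      (by
        intro g' hg' h0
        rw [← aux_hev, hφ] at h0
        by_contra hlt
        exact hmin g' hg' (by omega) h0)
      (by omega)
  rw [← hφ, map_intCast]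
  push_cast
  rw [this, hfn, sub_self]

lemma aux_Qgen {R k : Type*} [CommRing R] [Field k] (φ : R →+* k) (Q : Ideal R)
    (hφ : ∀ x, φ x = 0 ↔ x ∈ Q) {z : R} (hgen : ∀ x : R, ∃ a : ℤ[X], aeval z a = x)
    {l n : ℕ} (hl : l.Prime) (hlQ : (l : R) ∈ Q) {g : ℤ[X]} (hg : g.Monic) (hgn : g.natDegree = n)
    (hgQ : aeval z g ∈ Q) (hlow : ∀ g' : ℤ[X], g'.Monic → g'.natDegree < n → aeval z g' ∉ Q)
    (P : Ideal R) (hlP : (l : R) ∈ P) (hgP : aeval z g ∈ P) : Q ≤ P := by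
  intro x hx
  obtain ⟨a, rfl⟩ := hgen x
  have := Fact.mk hl
  have : CharP k l := aux_charP hl (by rw [← map_natCast φ, hφ]; exact hlQ)
  let _ : Algebra (ZMod l) k := ZMod.algebra _ l
  have hm := aux_map_minpoly (l := l) (w := φ z) hg
      (by rw [← aux_hev, hφ]; exact hgQ)
      (by
        intro g' hg' h0
        rw [← aux_hev, hφ] at h0
        by_contra hlt
        exact hlow g' hg' (by omega) h0)
  have hdvd : minpoly (ZMod l) (φ z) ∣ a.map (Int.castRingHom (ZMod l)) := by
    apply minpoly.dvd
    have : aeval (φ z) (a.map (Int.castRingHom (ZMod l))) = aeval (φ z) a := by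
      rw [aeval_def, eval₂_map, aeval_def]
      congr 1
      exact RingHom.ext_int _ _
    rw [this, ← aux_hev, hφ]
    exact hx
  rw [← hm] at hdvd
  obtain ⟨q, hq⟩ := hdvd
  obtain ⟨q', rfl⟩ := Polynomial.map_surjective (Int.castRingHom (ZMod l))
    ZMod.intCast_surjective q
  have h1 : (C (l : ℤ)) ∣ a - g * q' := by
    rw [Polynomial.C_dvd_iff_dvd_coeff]
    intro i
    have := congrArg (fun f => f.coeff i) hq
    simp only [← Polynomial.map_mul, coeff_map, eq_intCast] at this
    rw [coeff_sub]
    exact dvd_sub_comm.1 ((ZMod.intCast_eq_intCast_iff_dvd_sub _ _ l).1 this)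
  obtain ⟨r, hr⟩ := h1
  have : a = g * q' + C (l : ℤ) * r := by rw [← hr]; ring
  rw [this, map_add, map_mul, map_mul]
  refine P.add_mem (P.mul_mem_right _ hgP) (P.mul_mem_right _ ?_)
  simpa using hlP

lemma aux_of_primes {R : Type*} [CommRing R] [IsDedekindDomain R] (S : Subgroup (ClassGroup R))
    (I : Ideal R) : ∀ hI : I ∈ (Ideal R)⁰,
    (∀ P : (Ideal R)⁰, (P : Ideal R).IsPrime → I ≤ P → ClassGroup.mk0 P ∈ S) →
    ClassGroup.mk0 ⟨I, hI⟩ ∈ S := by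
  induction I using UniqueFactorizationMonoid.induction_on_prime with
  | h₁ => intro hI; exact absurd rfl (nonZeroDivisors.ne_zero hI)
  | h₂ I h =>
    intro hI _
    have : ClassGroup.mk0 ⟨I, hI⟩ = 1 := by
      rw [ClassGroup.mk0_eq_one_iff]
      have : I = ⊤ := Ideal.isUnit_iff.1 h
      subst this
      infer_instance
    rw [this]; exact S.one_mem
  | h₃ a P ha hP ih =>
    intro hI hall
    have ha' : a ∈ (Ideal R)⁰ := mem_nonZeroDivisors_of_ne_zero ha
    have hP' : P ∈ (Ideal R)⁰ := mem_nonZeroDivisors_of_ne_zero hP.ne_zero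
    have : (⟨P * a, hI⟩ : (Ideal R)⁰) = ⟨P, hP'⟩ * ⟨a, ha'⟩ := rfl
    rw [this, map_mul]
    exact S.mul_mem (hall ⟨P, hP'⟩ (Ideal.isPrime_of_prime hP) Ideal.mul_le_left)
      (ih ha' fun P' h1 h2 => hall P' h1 (Ideal.mul_le_right.trans h2))

set_option maxHeartbeats 1000000 in
lemma aux_gen {R : Type*} [CommRing R] [IsDedekindDomain R] [Module.Free ℤ R]
    [Module.Finite ℤ R] {z : R} {p : ℕ} (hp : p.Prime)
    (hz : z ^ p = 1) (hgen : ∀ x : R, ∃ a : ℤ[X], aeval z a = x)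
    (S : Subgroup (ClassGroup R))
    (hS : ∀ Q : (Ideal R)⁰, (Q : Ideal R).IsPrime → (∃ t : ℤ, z - t ∈ (Q : Ideal R)) →
      ClassGroup.mk0 Q ∈ S) (n : ℕ) :
    ∀ Q : (Ideal R)⁰, (Q : Ideal R).IsPrime → ∀ g : ℤ[X], g.Monic → g.natDegree = n →
      aeval z g ∈ (Q : Ideal R) → ClassGroup.mk0 Q ∈ S := by
  induction n using Nat.strong_induction_on with
  | _ n ih =>
  rintro ⟨Q, hQmem⟩ hQ g hg hgn hgQ
  simp only at hQ hgQ
  have hQ0 : Q ≠ ⊥ := nonZeroDivisors.ne_zero hQmem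
  by_cases hlow : ∃ g' : ℤ[X], g'.Monic ∧ g'.natDegree < n ∧ aeval z g' ∈ Q
  · obtain ⟨g', h1, h2, h3⟩ := hlow
    exact ih _ h2 ⟨Q, hQmem⟩ hQ g' h1 rfl h3
  push Not at hlow
  -- the constant term congruence
  have hconst : ∀ P : Ideal R, P.IsPrime → P ≠ ⊥ → ∀ f : ℤ[X], f.Monic → f.natDegree = n → 2 ≤ n →
      aeval z f ∈ P → (∀ g' : ℤ[X], g'.Monic → g'.natDegree < n → aeval z g' ∉ P) →
      ((f.coeff 0 - (-1) ^ n : ℤ) : R) ∈ P := by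
    intro P hP hP0 f hf hfn h2 hfP hmin
    have := hP.isMaximal hP0
    let _ := Ideal.Quotient.field P
    obtain ⟨l, hl, hlP⟩ := aux_exists_prime P hP0
    exact aux_const2 (Ideal.Quotient.mk P) P (fun x => Ideal.Quotient.eq_zero_iff_mem) hl hp hlP hz
      hf hfn h2 hfP hmin
  rcases Nat.lt_or_ge n 2 with hn | hn
  · interval_cases n
    · rw [hg.natDegree_eq_zero.1 hgn, map_one] at hgQ
      exact absurd ((Ideal.eq_top_iff_one _).2 hgQ) hQ.ne_top
    · refine hS _ hQ ⟨-g.coeff 0, ?_⟩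
      rw [hg.eq_X_add_C hgn] at hgQ
      simpa using hgQ
  obtain ⟨l, hl, hlQ⟩ := aux_exists_prime Q hQ0
  have hlp : l ≠ p := by
    rintro rfl
    refine hlow (X - C 1) (monic_X_sub_C 1) (by rw [natDegree_X_sub_C]; omega) ?_
    have := Fact.mk hl
    have : CharP (R ⧸ Q) l := aux_charP hl
      (by rw [← map_natCast (Ideal.Quotient.mk Q), Ideal.Quotient.eq_zero_iff_mem]; exact hlQ)
    rw [← Ideal.Quotient.eq_zero_iff_mem]
    have : (Ideal.Quotient.mk Q (aeval z (X - C 1 : ℤ[X]))) ^ l = 0 := by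
      simp only [map_sub, aeval_X, map_one]
      rw [sub_pow_char, ← map_pow, hz]
      simp
    exact pow_eq_zero_iff hl.ne_zero |>.1 this
  have hunram := aux_unram_s12 hp hz hgen hl hlp Q hQ0
  have hQgen : ∀ P : Ideal R, (l : R) ∈ P → aeval z g ∈ P → Q ≤ P := by
    intro P hlP hgP
    have := hQ.isMaximal hQ0
    let _ := Ideal.Quotient.field Q
    exact aux_Qgen (Ideal.Quotient.mk Q) Q (fun x => Ideal.Quotient.eq_zero_iff_mem) hgen hl hlQ
      hg hgn hgQ hlow P hlP hgP
  have hzQ : z ∉ Q := by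
    intro h
    have := Ideal.pow_mem_of_mem Q h p hp.pos
    rw [hz] at this
    exact hQ.ne_top ((Ideal.eq_top_iff_one _).2 this)
  obtain ⟨e, he⟩ : (l : ℤ) ∣ g.coeff 0 - (-1) ^ n := by
    have h1 := hconst Q hQ hQ0 g hg hgn hn hgQ hlow
    by_contra hnd
    have hco : IsCoprime (l : ℤ) (g.coeff 0 - (-1) ^ n) :=
      (Nat.prime_iff_prime_int.1 hl).coprime_iff_not_dvd.2 hnd
    obtain ⟨a, b, hab⟩ := hco
    have h3 : ((a * l + b * (g.coeff 0 - (-1) ^ n) : ℤ) : R) ∈ Q := by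
      rw [Int.cast_add, Int.cast_mul, Int.cast_mul b]
      refine Q.add_mem (Q.mul_mem_left _ (by simpa using hlQ)) (Q.mul_mem_left _ h1)
    rw [hab] at h3
    exact hQ.ne_top ((Ideal.eq_top_iff_one _).2 (by simpa using h3))
  -- the polynomial b
  obtain ⟨b, hb, hbn, hb0, ⟨r, hbr⟩, hbQ2⟩ : ∃ b : ℤ[X], b.Monic ∧ b.natDegree = n ∧
      b.coeff 0 = (-1 : ℤ) ^ n + (l : ℤ) ∧ (∃ r, aeval z b = aeval z g + l * r) ∧ aeval z b ∉ Q ^ 2 := by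
    have key : ∀ d : ℤ, (g + (C (l * (1 - e)) + C d * X)).Monic ∧
        (g + (C (l * (1 - e)) + C d * X)).natDegree = n ∧
        (g + (C (l * (1 - e)) + C d * X)).coeff 0 = (-1 : ℤ) ^ n + (l : ℤ) := by
      intro d
      have hdeg : (C (l * (1 - e)) + C d * X).degree < g.degree := by
        rw [degree_eq_natDegree hg.ne_zero, hgn, add_comm]
        refine lt_of_le_of_lt degree_linear_le ?_
        exact_mod_cast hn
      refine ⟨hg.add_of_left hdeg, ?_, ?_⟩
      · rw [natDegree_add_eq_left_of_degree_lt hdeg, hgn]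
      · simp only [coeff_add, coeff_C_zero, mul_coeff_zero, coeff_X_zero, mul_zero, add_zero]
        linear_combination he
    by_cases hQ2 : aeval z (g + (C (l * (1 - e)) + C 0 * X)) ∈ Q ^ 2
    · refine ⟨_, (key l).1, (key l).2.1, (key l).2.2, ⟨(1 - e) + z, ?_⟩, ?_⟩
      · simp; ring
      · intro h
        have h3 := (Q ^ 2).sub_mem h hQ2
        have h4 : (l : R) * z ∈ Q ^ 2 := by
          convert h3 using 1
          simp
        apply hunram
        have h5 := (Q ^ 2).mul_mem_right (z ^ (p - 1)) h4
        rwa [mul_assoc, ← pow_succ', Nat.sub_add_cancel hp.one_le, hz, mul_one] at h5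
    · refine ⟨_, (key 0).1, (key 0).2.1, (key 0).2.2, ⟨(1 - e), ?_⟩, hQ2⟩
      simp
  have hbQ : aeval z b ∈ Q := by
    rw [hbr]; exact Q.add_mem hgQ (Q.mul_mem_right _ hlQ)
  obtain ⟨I, hI⟩ : Q ∣ Ideal.span {aeval z b} := by
    rw [Ideal.dvd_span_singleton]; exact hbQ
  have hb00 : aeval z b ≠ 0 := fun h => hbQ2 (h ▸ (Q ^ 2).zero_mem)
  have hI0 : I ≠ 0 := by
    rintro rfl
    rw [mul_zero] at hI
    exact hb00 (Ideal.span_singleton_eq_bot.1 hI)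
  have hImem : I ∈ (Ideal R)⁰ := mem_nonZeroDivisors_of_ne_zero hI0
  have hprod : ClassGroup.mk0 ⟨Q, hQmem⟩ * ClassGroup.mk0 ⟨I, hImem⟩ = 1 := by
    rw [← map_mul]
    have h6 : Q * I ∈ (Ideal R)⁰ := mul_mem hQmem hImem
    change ClassGroup.mk0 ⟨Q * I, h6⟩ = 1
    rw [ClassGroup.mk0_eq_one_iff, ← hI]
    exact ⟨⟨_, rfl⟩⟩
  rw [eq_inv_of_mul_eq_one_left hprod]
  refine S.inv_mem (aux_of_primes S I hImem ?_)
  rintro ⟨P, hPmem⟩ hP hIP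
  simp only at hP hIP
  have hP0 : P ≠ ⊥ := nonZeroDivisors.ne_zero hPmem
  have hbP : aeval z b ∈ P := by
    apply hIP
    have : aeval z b ∈ Q * I := by rw [← hI]; exact Ideal.mem_span_singleton_self _
    exact Ideal.mul_le_right this
  by_cases hlowP : ∃ g' : ℤ[X], g'.Monic ∧ g'.natDegree < n ∧ aeval z g' ∈ P
  · obtain ⟨g', h1, h2, h3⟩ := hlowP
    exact ih _ h2 ⟨P, hPmem⟩ hP g' h1 rfl h3
  push Not at hlowP
  exfalso
  have hlP : (l : R) ∈ P := by
    have := hconst P hP hP0 b hb hbn hn hbP hlowP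
    rw [hb0] at this
    simpa using this
  have hgP : aeval z g ∈ P := by
    have : aeval z g = aeval z b - l * r := by rw [hbr]; ring
    rw [this]; exact P.sub_mem hbP (P.mul_mem_right _ hlP)
  have hQP : Q = P := (hQ.isMaximal hQ0).eq_of_le hP.ne_top (hQgen P hlP hgP)
  apply hbQ2
  have h7 : aeval z b ∈ Q * I := by rw [← hI]; exact Ideal.mem_span_singleton_self _
  rw [pow_two]
  exact Ideal.mul_mono_right (hQP ▸ hIP) h7

lemma aux_gen_top {R : Type*} [CommRing R] [IsDedekindDomain R] [Module.Free ℤ R]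
    [Module.Finite ℤ R] {z : R} {p : ℕ} (hp : p.Prime)
    (hz : z ^ p = 1) (hgen : ∀ x : R, ∃ a : ℤ[X], aeval z a = x)
    (S : Subgroup (ClassGroup R))
    (hS : ∀ Q : (Ideal R)⁰, (Q : Ideal R).IsPrime → (∃ t : ℤ, z - t ∈ (Q : Ideal R)) →
      ClassGroup.mk0 Q ∈ S) (x : ClassGroup R) : x ∈ S := by
  obtain ⟨⟨I, hI⟩, rfl⟩ := ClassGroup.mk0_surjective x
  refine aux_of_primes S I hI fun P hP _ => ?_
  refine aux_gen hp hz hgen S hS _ P hP (X ^ p - C 1) (monic_X_pow_sub_C 1 hp.ne_zero) rfl ?_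
  simp [hz]

lemma aux_powsum {F : Type*} [Field F] [Fintype F] (a b : ℕ) (hab : a + b < Fintype.card F - 1) :
    ∑ x : F, x ^ a * (1 - x) ^ b = 0 := by
  have h1 : ∀ x : F, x ^ a * (1 - x) ^ b =
      ∑ k ∈ Finset.range (b + 1), (-1) ^ k * (b.choose k : F) * x ^ (a + k) := by
    intro x
    rw [sub_eq_neg_add, add_pow, Finset.mul_sum]
    refine Finset.sum_congr rfl fun k _ => ?_
    rw [neg_pow]; ring
  simp_rw [h1]
  rw [Finset.sum_comm]
  refine Finset.sum_eq_zero fun k hk => ?_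
  rw [← Finset.mul_sum, FiniteField.sum_pow_lt_card_sub_one, mul_zero]
  have := Finset.mem_range.1 hk
  omega

lemma aux_jacobi_mem {R F : Type*} [CommRing R] [Field F] [Fintype F] (φ : R →+* F)
    (χ : MulChar F R) (m p : ℕ) (hm : m * p = Fintype.card F - 1) (hm0 : 0 < m)
    (hχ : ∀ x, φ (χ x) = x ^ m) (a b : ℕ) (ha : 0 < a) (hb : 0 < b) (hab : a + b < p) :
    φ (jacobiSum (χ ^ a) (χ ^ b)) = 0 := by
  rw [jacobiSum, map_sum]
  rw [← aux_powsum (F := F) (m * a) (m * b)]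
  · refine Finset.sum_congr rfl fun x _ => ?_
    rw [map_mul, MulChar.pow_apply' _ ha.ne', MulChar.pow_apply' _ hb.ne', map_pow, map_pow, hχ, hχ,
      pow_mul, pow_mul]
  · rw [← mul_add, ← hm]
    exact Nat.mul_lt_mul_of_pos_left hab hm0

lemma aux_exists_char {R F : Type*} [CommRing R] [IsDomain R] [Field F] [Fintype F] (φ : R →+* F)
    (p : ℕ) (hp : p.Prime) {z : R} (hz : IsPrimitiveRoot z p) (hφz : IsPrimitiveRoot (φ z) p) :
    ∃ (m : ℕ) (χ : MulChar F R), m * p = Fintype.card F - 1 ∧ 0 < m ∧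
      (∀ x, φ (χ x) = x ^ m) ∧ χ ^ p = 1 ∧ (∀ a, 0 < a → a < p → χ ^ a ≠ 1) := by
  classical
  have := NeZero.mk hp.ne_zero
  have hdvd : p ∣ Fintype.card F - 1 := by
    rw [hφz.eq_orderOf]
    apply orderOf_dvd_of_pow_eq_one
    exact FiniteField.pow_card_sub_one_eq_one _ (hφz.ne_zero hp.ne_zero)
  obtain ⟨m, hm⟩ := hdvd
  have hcard : 1 < Fintype.card F := Fintype.one_lt_card
  have hm0 : 0 < m := by
    rcases Nat.eq_zero_or_pos m with h | h
    · rw [h] at hm; omega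
    · exact h
  have hzu : IsUnit z := hz.isUnit hp.ne_zero
  let zu : Rˣ := hzu.unit
  -- the map on roots of unity
  let e : rootsOfUnity p R →* rootsOfUnity p F := restrictRootsOfUnity φ p
  have hinj : Function.Injective e := by
    intro a b hab
    obtain ⟨i, hi, hia⟩ := hz.eq_pow_of_pow_eq_one (ξ := ((a : Rˣ) : R))
      (by rw [← Units.val_pow_eq_pow_val, (mem_rootsOfUnity _ _).1 a.2]; rfl)
    obtain ⟨j, hj, hjb⟩ := hz.eq_pow_of_pow_eq_one (ξ := ((b : Rˣ) : R))
      (by rw [← Units.val_pow_eq_pow_val, (mem_rootsOfUnity _ _).1 b.2]; rfl)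
    have h1 : φ ((a : Rˣ) : R) = φ ((b : Rˣ) : R) := by
      have := congrArg (fun t : rootsOfUnity p F => ((t : Fˣ) : F)) hab
      simpa [e] using this
    rw [← hia, ← hjb, map_pow, map_pow] at h1
    have h2 := hφz.pow_inj hi hj h1
    apply Subtype.ext
    apply Units.ext
    rw [← hia, ← hjb, h2]
  have hsurj : Function.Surjective e := by
    intro b
    obtain ⟨j, hj, hjb⟩ := hφz.eq_pow_of_pow_eq_one (ξ := ((b : Fˣ) : F))
      (by rw [← Units.val_pow_eq_pow_val, (mem_rootsOfUnity _ _).1 b.2]; rfl)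
    refine ⟨⟨zu ^ j, ?_⟩, ?_⟩
    · rw [mem_rootsOfUnity]
      apply Units.ext
      simp [zu, ← pow_mul, mul_comm j p]
      simp [pow_mul, hz.pow_eq_one]
    · apply Subtype.ext
      apply Units.ext
      simp [e, zu, ← hjb]
  let E : rootsOfUnity p R ≃* rootsOfUnity p F := MulEquiv.ofBijective e ⟨hinj, hsurj⟩
  let f : Fˣ →* rootsOfUnity p F := (powMonoidHom m).codRestrict _ (by
    intro u
    rw [mem_rootsOfUnity, powMonoidHom_apply, ← pow_mul, mul_comm, ← hm]
    apply Units.ext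
    simpa using FiniteField.pow_card_sub_one_eq_one (u : F) u.ne_zero)
  let χ : MulChar F R := MulChar.ofUnitHom
    ((Subgroup.subtype _).comp ((E.symm : rootsOfUnity p F →* rootsOfUnity p R).comp f))
  have hχu : ∀ u : Fˣ, χ u = (((E.symm (f u)) : Rˣ) : R) := by
    intro u
    simp only [χ]
    rw [MulChar.ofUnitHom_coe]
    rfl
  have hχ : ∀ x, φ (χ x) = x ^ m := by
    intro x
    by_cases hx : x = 0
    · subst hx
      rw [MulChar.map_zero, map_zero, zero_pow hm0.ne']
    · obtain ⟨u, rfl⟩ : ∃ u : Fˣ, (u : F) = x := ⟨Units.mk0 x hx, rfl⟩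
      rw [hχu]
      have h1 : e (E.symm (f u)) = f u := E.apply_symm_apply (f u)
      have := congrArg (fun t : rootsOfUnity p F => ((t : Fˣ) : F)) h1
      simpa [e, f] using this
  refine ⟨m, χ, by rw [hm, mul_comm], hm0, hχ, ?_, ?_⟩
  · ext u
    rw [MulChar.pow_apply_coe, hχu, MulChar.one_apply_coe, ← Units.val_pow_eq_pow_val,
      (mem_rootsOfUnity _ _).1 (E.symm (f u)).2]
    rfl
  · intro a ha hap h1
    obtain ⟨g, hg⟩ := IsCyclic.exists_generator (α := Fˣ)
    have h2 : (g : F) ^ (m * a) = 1 := by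
      rw [pow_mul, ← hχ, ← map_pow, ← MulChar.pow_apply_coe, h1, MulChar.one_apply_coe, map_one]
    have h3 : g ^ (m * a) = 1 := Units.ext (by simpa using h2)
    have h4 := orderOf_dvd_of_pow_eq_one h3
    rw [orderOf_eq_card_of_forall_mem_zpowers hg, Nat.card_eq_fintype_card, Fintype.card_units, hm,
      mul_comm p m] at h4
    have := Nat.le_of_dvd (by positivity) h4
    have := Nat.le_of_mul_le_mul_left this hm0
    omega

lemma aux_jacobi_mul {R F : Type*} [CommRing R] [IsDomain R] [CharZero R] [Field F] [Fintype F]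
    (χ ψ : MulChar F R) (h1 : χ ≠ 1) (h2 : ψ ≠ 1) (h3 : χ * ψ ≠ 1) :
    jacobiSum χ ψ * jacobiSum χ⁻¹ ψ⁻¹ = Fintype.card F := by
  set i := algebraMap R (FractionRing R) with hi
  have hinj : Function.Injective i := IsFractionRing.injective R (FractionRing R)
  have hinj' : ∀ χ ψ : MulChar F R, χ.ringHomComp i = ψ.ringHomComp i → χ = ψ := by
    intro χ ψ h
    exact (MulChar.injective_ringHomComp hinj) h
  have hone : (1 : MulChar F R).ringHomComp i = 1 := MulChar.ringHomComp_one i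
  have hch : ringChar (FractionRing R) ≠ ringChar F := by
    have : CharZero (FractionRing R) := charZero_of_injective_algebraMap hinj
    rw [ringChar.eq_zero]
    intro h
    have : CharP F 0 := ringChar.of_eq h.symm
    have := CharP.charP_to_charZero F
    exact absurd (inferInstance : Finite F)
      (not_finite_iff_infinite.2 (Infinite.of_injective _ (Nat.cast_injective (R := F))))
  have := jacobiSum_mul_jacobiSum_inv hch (χ := χ.ringHomComp i) (φ := ψ.ringHomComp i)
    (fun h => h1 (hinj' _ _ (h.trans hone.symm))) (fun h => h2 (hinj' _ _ (h.trans hone.symm)))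
    (fun h => h3 (hinj' _ _ ((MulChar.ringHomComp_mul χ ψ i).trans (h.trans hone.symm))))
  rw [MulChar.ringHomComp_inv, MulChar.ringHomComp_inv, jacobiSum_ringHomComp,
    jacobiSum_ringHomComp, ← map_mul] at this
  apply hinj
  rw [this, map_natCast]

lemma aux_factor {R ι : Type*} [CommRing R] [IsDedekindDomain R] [Module.Free ℤ R]
    [Module.Finite ℤ R] [Fintype ι] [DecidableEq ι] (A : ι → Ideal R) (hA : ∀ i, (A i).IsPrime)
    (hA0 : ∀ i, A i ≠ ⊥) (hinj : Function.Injective A) (q : ℕ) (hq : 0 < q)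
    (hN : ∀ i, Ideal.absNorm (A i) = q)
    (hcard : Fintype.card ι = Module.finrank ℤ R) (S : Finset ι) (J J' : R)
    (hJ : J * J' = q) (hS : ∀ i ∈ S, J ∈ A i) (hS' : ∀ i ∉ S, J' ∈ A i) :
    Ideal.span {J} = ∏ i ∈ S, A i := by
  have hdvd : ∀ (U : Finset ι) (x : R), (∀ i ∈ U, x ∈ A i) → ∏ i ∈ U, A i ∣ Ideal.span {x} := by
    intro U x hx
    apply Finset.prod_dvd_of_coprime
    · intro i _ j _ hij
      have := (hA i).isMaximal (hA0 i)
      have := (hA j).isMaximal (hA0 j)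
      exact Ideal.isCoprime_of_isMaximal (fun h => hij (hinj h))
    · intro i hi
      rw [Ideal.dvd_span_singleton]; exact hx i hi
  obtain ⟨I, hI⟩ := hdvd S J hS
  obtain ⟨I', hI'⟩ := hdvd Sᶜ J' (fun i hi => hS' i (Finset.mem_compl.1 hi))
  have h1 : Ideal.absNorm (Ideal.span {(q : R)}) = q ^ Fintype.card ι := by
    rw [Ideal.absNorm_span_singleton, hcard]
    have : (q : R) = algebraMap ℤ R q := by simp
    rw [this, Algebra.norm_algebraMap]
    simp
  have h2 : Ideal.span {(q : R)} = (∏ i, A i) * (I * I') := by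
    rw [← hJ, ← Ideal.span_singleton_mul_span_singleton, hI, hI', ← Finset.prod_mul_prod_compl S]
    ring
  have h3 : q ^ Fintype.card ι = q ^ Fintype.card ι * (Ideal.absNorm I * Ideal.absNorm I') := by
    conv_lhs => rw [← h1, h2, map_mul, map_mul, map_prod]
    simp [hN]
  have h4 : Ideal.absNorm I * Ideal.absNorm I' = 1 := by
    have := pow_pos hq (Fintype.card ι)
    exact Nat.eq_of_mul_eq_mul_left this (by rw [← h3, mul_one])
  have h5 := Nat.eq_one_of_mul_eq_one_right h4
  rw [Ideal.absNorm_eq_one_iff] at h5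
  rw [hI, h5, Ideal.mul_top]

lemma aux_count_s12 (p : ℕ) (hp : p.Prime) (n : ℕ) (hn : 1 ≤ n) (hn' : n ≤ p - 1) :
    #{b ∈ Finset.Icc 1 (p - 2) | n + (n * b) % p < p} = p - 1 - n := by
  have hpos := hp.pos
  have hcop : Nat.Coprime p n := (Nat.Prime.coprime_iff_not_dvd hp).2
    (fun h => by have := Nat.le_of_dvd hn h; omega)
  have hnb : ∀ b, n * b % p = 0 → p ∣ b := fun b h =>
    hcop.dvd_of_dvd_mul_left (Nat.dvd_of_mod_eq_zero h)
  have hinj : ∀ a b, a < p → b < p → n * a % p = n * b % p → a = b := by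
    intro a b ha hb h
    have h1 : n * a ≡ n * b [MOD p] := h
    exact (Nat.ModEq.cancel_left_of_coprime hcop h1).eq_of_lt_of_lt ha hb
  have hcI : #(Finset.Icc 1 (p - 1 - n)) = p - 1 - n := by simp
  rw [← hcI]
  refine Finset.card_bij (fun b _ => n * b % p) ?_ ?_ ?_
  · intro b hb
    simp only [Finset.mem_filter, Finset.mem_Icc] at hb ⊢
    have h1 : n * b % p ≠ 0 := fun h => by
      have := Nat.le_of_dvd (by omega) (hnb b h); omega
    omega
  · intro a ha b hb h
    simp only [Finset.mem_filter, Finset.mem_Icc] at ha hb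
    exact hinj a b (by omega) (by omega) h
  · intro r hr
    simp only [Finset.mem_Icc] at hr
    -- surjectivity of multiplication
    have hsurj : ∃ b < p, n * b % p = r := by
      have : Function.Surjective (fun b : Fin p => (⟨n * b % p, Nat.mod_lt _ hpos⟩ : Fin p)) := by
        apply Finite.surjective_of_injective
        intro a b h
        exact Fin.ext (hinj a b a.2 b.2 (by simpa using h))
      obtain ⟨b, hb⟩ := this ⟨r, by omega⟩
      exact ⟨b, b.2, by simpa using congrArg Fin.val hb⟩
    obtain ⟨b, hbp, hb⟩ := hsurj
    have hb0 : b ≠ 0 := by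
      rintro rfl
      simp at hb; omega
    have hb1 : b ≠ p - 1 := by
      rintro rfl
      have h1 : (n * (p - 1) + n) % p = 0 := by
        have : n * (p - 1) + n = n * p := by
          conv_rhs => rw [show p = (p - 1) + 1 by omega]
          ring
        rw [this]; exact Nat.mul_mod_left _ _
      rw [Nat.add_mod, hb, Nat.mod_eq_of_lt (show n < p by omega),
        Nat.mod_eq_of_lt (show r + n < p by omega)] at h1
      omega
    refine ⟨b, ?_, hb⟩
    simp only [Finset.mem_filter, Finset.mem_Icc]
    omega

lemma aux_core {R F : Type*} [CommRing R] [IsDomain R] [CharZero R] [Field F] [Fintype F]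
    (φ : R →+* F) (p : ℕ) (hp : p.Prime) {z : R} (hz : IsPrimitiveRoot z p)
    (hφz : IsPrimitiveRoot (φ z) p) (b : ℕ) (hb : 1 ≤ b) (hb' : b ≤ p - 2) :
    ∃ J J' : R, J * J' = Fintype.card F ∧ ∀ (τ : R ≃+* R) (n : ℕ), τ z = z ^ n → 1 ≤ n → n ≤ p - 1 →
      (n + n * b % p < p → φ (τ J) = 0) ∧ (¬ (n + n * b % p < p) → φ (τ J') = 0) := by
  have hp2 := hp.two_le
  have := NeZero.mk hp.ne_zero
  obtain ⟨m, χ, hm, hm0, hχ, hχp, hχa⟩ := aux_exists_char φ p hp hz hφz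
  refine ⟨jacobiSum χ (χ ^ b), jacobiSum χ⁻¹ (χ ^ b)⁻¹, ?_, ?_⟩
  · apply aux_jacobi_mul
    · simpa using hχa 1 one_pos (by omega)
    · exact hχa b hb (by omega)
    · rw [← pow_succ']; exact hχa _ (by omega) (by omega)
  intro τ n hτ hn hn'
  have hcop : Nat.Coprime p n := (Nat.Prime.coprime_iff_not_dvd hp).2
    (fun h => by have := Nat.le_of_dvd hn h; omega)
  have hcomp : χ.ringHomComp (τ : R →+* R) = χ ^ n := by
    ext u
    obtain ⟨k, _, hk⟩ := MulChar.exists_apply_eq_pow hχp hz (a := (u : F)) u.ne_zero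
    rw [MulChar.ringHomComp_apply, MulChar.pow_apply_coe, hk]
    simp [hτ, ← pow_mul, mul_comm]
  have hτJ : ∀ χ ψ : MulChar F R, τ (jacobiSum χ ψ) =
      jacobiSum (χ.ringHomComp (τ : R →+* R)) (ψ.ringHomComp (τ : R →+* R)) := by
    intro χ ψ
    rw [jacobiSum_ringHomComp]; rfl
  have hr : n * b % p ≠ 0 := fun h => by
    have := Nat.le_of_dvd (by omega) (hcop.dvd_of_dvd_mul_left (Nat.dvd_of_mod_eq_zero h)); omega
  have hrp : n * b % p < p := Nat.mod_lt _ hp.pos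
  have hpow : (χ ^ b).ringHomComp (τ : R →+* R) = χ ^ (n * b % p) := by
    rw [← MulChar.ringHomComp_pow, hcomp, ← pow_mul, ← pow_mod_orderOf,
      ← pow_mod_orderOf (n := n * b % p)]
    rw [Nat.mod_mod_of_dvd _ (orderOf_dvd_of_pow_eq_one hχp)]
  have hinv : ∀ a, a ≤ p → (χ ^ a)⁻¹ = χ ^ (p - a) := by
    intro a ha
    rw [inv_eq_iff_mul_eq_one, ← pow_add, Nat.add_sub_cancel' ha, hχp]
  constructor
  · intro hlt
    rw [hτJ, hcomp, hpow]
    exact aux_jacobi_mem φ χ m p hm hm0 hχ _ _ hn (Nat.pos_of_ne_zero hr) hlt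
  · intro hge
    have hne : n + n * b % p ≠ p := by
      intro h
      have h1 : p ∣ n * (b + 1) := by
        have : (n * (b + 1)) % p = 0 := by
          rw [mul_add, mul_one, Nat.add_mod, Nat.mod_eq_of_lt (show n < p by omega), add_comm, h,
            Nat.mod_self]
        exact Nat.dvd_of_mod_eq_zero this
      have := Nat.le_of_dvd (by omega) (hcop.dvd_of_dvd_mul_left h1)
      omega
    rw [hτJ, ← MulChar.ringHomComp_inv, ← MulChar.ringHomComp_inv, hcomp, hpow,
      hinv _ (by omega), hinv _ hrp.le]
    exact aux_jacobi_mem φ χ m p hm hm0 hχ _ _ (by omega) (by omega) (by omega)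


lemma aux_map_mem {R : Type*} [CommRing R] (e : R ≃+* R) (Q : Ideal R) (x : R) :
    x ∈ Ideal.map e Q ↔ e.symm x ∈ Q := by
  rw [Ideal.mem_map_of_equiv]
  constructor
  · rintro ⟨y, hy, rfl⟩; simpa using hy
  · intro h; exact ⟨_, h, by simp⟩

lemma aux_card_map {R : Type*} [CommRing R] [IsDedekindDomain R] [Module.Free ℤ R]
    (e : R ≃+* R) (Q : Ideal R) : Ideal.absNorm (Ideal.map e Q) = Ideal.absNorm Q := by
  rw [Ideal.absNorm_apply, Ideal.absNorm_apply, Submodule.cardQuot_apply, Submodule.cardQuot_apply]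
  exact (Nat.card_congr (Ideal.quotientEquiv Q (Ideal.map e Q) e rfl).toEquiv).symm

lemma aux_group_s12 {M : Type*} [CommGroup M] (p : ℕ) (hp : p.Prime) (x : Fin (p - 1) → M)
    (N : Fin (p - 1) → ℕ) (hN : ∀ i, 1 ≤ N i ∧ N i ≤ p - 1)
    (h : ∀ b ∈ Finset.Icc 1 (p - 2), ∏ i with N i + N i * b % p < p, x i = 1)
    (h1 : ∏ i, x i = 1) : ∏ i, x i ^ N i = 1 := by
  have h2 : ∏ i, x i ^ (p - 1 - N i) = 1 := by
    have : ∏ b ∈ Finset.Icc 1 (p - 2), ∏ i with N i + N i * b % p < p, x i = 1 :=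
      Finset.prod_eq_one h
    rw [← this]
    simp_rw [Finset.prod_filter]
    rw [Finset.prod_comm]
    refine Finset.prod_congr rfl fun i _ => ?_
    rw [← Finset.prod_filter, Finset.prod_const, aux_count_s12 p hp _ (hN i).1 (hN i).2]
  have h3 : (∏ i, x i ^ N i) * ∏ i, x i ^ (p - 1 - N i) = 1 := by
    rw [← Finset.prod_mul_distrib]
    calc _ = ∏ i, x i ^ (p - 1) := by
          refine Finset.prod_congr rfl fun i _ => ?_
          rw [← pow_add, Nat.add_sub_cancel' (hN i).2]
      _ = 1 := by rw [Finset.prod_pow, h1, one_pow]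
  rwa [h2, mul_one] at h3

lemma aux_one_sub {R : Type*} [CommRing R] [IsDomain R] {p : ℕ} (hp : p.Prime) {z : R}
    (hz : IsPrimitiveRoot z p) (I : Ideal R) (hI : z - 1 ∈ I) : (p : R) ∈ I := by
  have h1 := hz.geom_sum_eq_zero hp.one_lt
  rw [← Ideal.Quotient.eq_zero_iff_mem, map_sub, map_one, sub_eq_zero] at hI
  have h2 := congrArg (Ideal.Quotient.mk I) h1
  rw [map_sum, map_zero] at h2
  simp only [map_pow, hI, one_pow] at h2
  rw [← Ideal.Quotient.eq_zero_iff_mem, map_natCast]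
  simpa using h2

lemma aux_core_field {R F : Type*} [CommRing R] [IsDomain R] [CharZero R] [Field F] [Fintype F]
    (φ : R →+* F) (Q : Ideal R) (hφ : ∀ x, φ x = 0 ↔ x ∈ Q)
    {p : ℕ} (hp : p.Prime) {z : R} (hz : IsPrimitiveRoot z p)
    (hpQ : (p : R) ∉ Q) (b : ℕ) (hb : 1 ≤ b) (hb' : b ≤ p - 2) :
    ∃ J J' : R, J * J' = Nat.card F ∧ ∀ (τ : R ≃+* R) (n : ℕ), τ z = z ^ n → 1 ≤ n →
      n ≤ p - 1 → (n + n * b % p < p → τ J ∈ Q) ∧ (¬ (n + n * b % p < p) → τ J' ∈ Q) := by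
  have := Fact.mk hp
  have hφz : IsPrimitiveRoot (φ z) p := by
    have h1 : orderOf (φ z) = p := by
      apply orderOf_eq_prime
      · rw [← map_pow, hz.pow_eq_one, map_one]
      · intro h
        apply hpQ
        apply aux_one_sub hp hz
        rw [← hφ, map_sub, map_one, h, sub_self]
    have h2 := IsPrimitiveRoot.orderOf (φ z)
    rwa [h1] at h2
  obtain ⟨J, J', hJJ, hJ⟩ := aux_core φ p hp hz hφz b hb hb'
  refine ⟨J, J', by rw [hJJ, Nat.card_eq_fintype_card], fun τ n h1 h2 h3 => ?_⟩
  rw [← hφ, ← hφ]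
  exact hJ τ n h1 h2 h3

lemma aux_core_quot {R : Type*} [CommRing R] [IsDedekindDomain R] [CharZero R] [Module.Free ℤ R]
    [Module.Finite ℤ R] (Q : Ideal R) (hQ : Q.IsPrime) (hQ0 : Q ≠ ⊥)
    {p : ℕ} (hp : p.Prime) {z : R} (hz : IsPrimitiveRoot z p)
    (hpQ : (p : R) ∉ Q) (b : ℕ) (hb : 1 ≤ b) (hb' : b ≤ p - 2) :
    ∃ J J' : R, J * J' = (Ideal.absNorm Q : ℕ) ∧ ∀ (τ : R ≃+* R) (n : ℕ), τ z = z ^ n → 1 ≤ n →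
      n ≤ p - 1 → (n + n * b % p < p → τ J ∈ Q) ∧ (¬ (n + n * b % p < p) → τ J' ∈ Q) := by
  have hmax := hQ.isMaximal hQ0
  have hfin := Ideal.finiteQuotientOfFreeOfNeBot Q hQ0
  have ft : Fintype (R ⧸ Q) := Fintype.ofFinite _
  have hcard : Ideal.absNorm Q = Nat.card (R ⧸ Q) := by
    rw [Ideal.absNorm_apply, Submodule.cardQuot_apply]
  rw [hcard]
  exact @aux_core_field R (R ⧸ Q) _ _ _ (Ideal.Quotient.field Q) ft (Ideal.Quotient.mk Q) Q
    (fun x => Ideal.Quotient.eq_zero_iff_mem) p hp z hz hpQ b hb hb'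

lemma aux_ram {R : Type*} [CommRing R] [IsDedekindDomain R] {p : ℕ} (hp : p.Prime) {z : R}
    (hz : IsPrimitiveRoot z p) (hz1 : Prime (z - 1)) (Q : (Ideal R)⁰)
    (hQ : (Q : Ideal R).IsPrime) (hpQ : (p : R) ∈ (Q : Ideal R)) : ClassGroup.mk0 Q = 1 := by
  have := Fact.mk hp
  have hzQ : z - 1 ∈ (Q : Ideal R) := by
    have hnt : Nontrivial (R ⧸ (Q : Ideal R)) := Ideal.Quotient.nontrivial_iff.2 hQ.ne_top
    have : CharP (R ⧸ (Q : Ideal R)) p := aux_charP hp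
      (by rw [← map_natCast (Ideal.Quotient.mk (Q : Ideal R)), Ideal.Quotient.eq_zero_iff_mem]
          exact hpQ)
    rw [← Ideal.Quotient.eq_zero_iff_mem]
    have : (Ideal.Quotient.mk (Q : Ideal R) (z - 1)) ^ p = 0 := by
      rw [map_sub, map_one, sub_pow_char, ← map_pow, hz.pow_eq_one]
      simp
    exact pow_eq_zero_iff hp.ne_zero |>.1 this
  have h1 : Ideal.span {z - 1} = (Q : Ideal R) := by
    have hsp : (Ideal.span {z - 1}).IsPrime :=
      (Ideal.span_singleton_prime hz1.ne_zero).2 hz1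
    refine (hsp.isMaximal ?_).eq_of_le hQ.ne_top ?_
    · rw [Ne, Ideal.span_singleton_eq_bot]; exact hz1.ne_zero
    · rw [Ideal.span_singleton_le_iff_mem]; exact hzQ
  have h2 : ClassGroup.mk0 Q = 1 := by
    have : ClassGroup.mk0 ⟨(Q : Ideal R), Q.2⟩ = 1 := by
      rw [ClassGroup.mk0_eq_one_iff, ← h1]
      exact ⟨⟨_, rfl⟩⟩
    exact this
  exact h2

lemma aux_dist {R : Type*} [CommRing R] [IsDomain R] {p : ℕ} (hp : p.Prime) {z : R}
    (hz : IsPrimitiveRoot z p) (I : Ideal R) (hI : I.IsPrime) (hpI : (p : R) ∉ I) (a b : ℕ)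
    (hmem : z ^ a - z ^ b ∈ I) : (a : ZMod p) = b := by
  have hbase : ∀ a b : ℕ, a ≤ b → z ^ a - z ^ b ∈ I → (a : ZMod p) = b := by
    intro a b hab hmem
    by_contra hne
    obtain ⟨d, rfl⟩ := Nat.exists_eq_add_of_le hab
    have hd : ¬ p ∣ d := by
      intro h
      apply hne
      push_cast
      rw [(ZMod.natCast_eq_zero_iff d p).2 h, add_zero]
    have h1 : z ^ a * (z ^ d - 1) ∈ I := by
      rw [← I.neg_mem_iff]
      convert hmem using 1
      rw [pow_add]; ring
    have hzu : z ^ a ∉ I := fun h => hI.ne_top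
      (Ideal.eq_top_of_isUnit_mem I h ((hz.isUnit hp.ne_zero).pow a))
    have h2 := (hI.mem_or_mem h1).resolve_left hzu
    have hzd : IsPrimitiveRoot (z ^ d) p :=
      hz.pow_of_coprime d ((Nat.Prime.coprime_iff_not_dvd hp).2 hd).symm
    exact hpI (aux_one_sub hp hzd I h2)
  rcases le_total a b with h | h
  · exact hbase a b h hmem
  · refine (hbase b a h ?_).symm
    rw [← I.neg_mem_iff]; simpa using hmem

lemma aux_cls {R ι : Type*} [CommRing R] [IsDedekindDomain R] (A' : ι → (Ideal R)⁰)
    (S : Finset ι) (J : R) (hJ : Ideal.span {J} = ∏ i ∈ S, (A' i : Ideal R)) :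
    ∏ i ∈ S, ClassGroup.mk0 (A' i) = 1 := by
  rw [← map_prod]
  have h1 : ((∏ i ∈ S, A' i : (Ideal R)⁰) : Ideal R) = Ideal.span {J} := by
    rw [hJ, Submonoid.coe_finsetProd]
  have h2 : ClassGroup.mk0 ⟨((∏ i ∈ S, A' i : (Ideal R)⁰) : Ideal R), (∏ i ∈ S, A' i).2⟩ = 1 := by
    rw [ClassGroup.mk0_eq_one_iff, h1]
    exact ⟨⟨_, rfl⟩⟩
  exact h2

set_option maxHeartbeats 1000000 in
lemma aux_stick {R : Type*} [CommRing R] [IsDedekindDomain R] [CharZero R] [Module.Free ℤ R]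
    [Module.Finite ℤ R] {p : ℕ} (hp : p.Prime) {z : R} (hz : IsPrimitiveRoot z p)
    (hrank : Module.finrank ℤ R = p - 1) (hz1 : Prime (z - 1)) (s : R ≃+* R) (v : ℕ)
    (hs : s z = z ^ v) (hv : orderOf (v : ZMod p) = p - 1) (N : ℕ → ℕ)
    (hN : ∀ i, 1 ≤ N i ∧ N i ≤ p - 1) (hNv : ∀ i, (N i : ZMod p) * (v : ZMod p) ^ i = 1)
    (T : MulAut (ClassGroup R))
    (hT : ∀ I J : (Ideal R)⁰, Ideal.map s (I : Ideal R) = (J : Ideal R) →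
      T (ClassGroup.mk0 I) = ClassGroup.mk0 J)
    (Q : (Ideal R)⁰) (hQ : (Q : Ideal R).IsPrime) (t : ℤ) (ht : z - t ∈ (Q : Ideal R)) :
    ∏ i : Fin (p - 1), ((T ^ (i : ℕ)) (ClassGroup.mk0 Q)) ^ N i = 1 := by
  classical
  have := Fact.mk hp
  have := NeZero.mk hp.ne_zero
  have hQ0 : (Q : Ideal R) ≠ ⊥ := nonZeroDivisors.ne_zero Q.2
  by_cases hpQ : (p : R) ∈ (Q : Ideal R)
  · rw [aux_ram hp hz hz1 Q hQ hpQ]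
    simp
  let A : Fin (p - 1) → Ideal R := fun i => Ideal.map ((s ^ (i : ℕ) : RingAut R) : R ≃+* R) Q
  have hspow : ∀ i : ℕ, (s ^ i : RingAut R) z = z ^ (v ^ i) := by
    intro i
    induction i with
    | zero => simp
    | succ i ih =>
      rw [pow_succ', RingAut.mul_apply, ih, map_pow, hs, ← pow_mul, pow_succ']
  have hzmod : ∀ a b : ℕ, (a : ZMod p) = b → z ^ a = z ^ b := by
    intro a b hab
    rw [ZMod.natCast_eq_natCast_iff] at hab
    have h1 : a % p = b % p := hab
    rw [← Nat.div_add_mod a p, ← Nat.div_add_mod b p, h1, pow_add, pow_add, pow_mul, pow_mul,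
      hz.pow_eq_one, one_pow, one_pow]
  have hsymm : ∀ i : ℕ, ((s ^ i : RingAut R) : R ≃+* R).symm z = z ^ N i := by
    intro i
    rw [RingEquiv.symm_apply_eq, map_pow, hspow, ← pow_mul]
    conv_lhs => rw [← pow_one z]
    apply hzmod
    push_cast
    rw [mul_comm, hNv]
  have hA : ∀ i, (A i).IsPrime := fun i => Ideal.map_isPrime_of_equiv _
  have hA0 : ∀ i, A i ≠ ⊥ := by
    intro i h
    exact hQ0 ((Ideal.map_eq_bot_iff_of_injective (RingEquiv.injective _)).1 h)
  have hpA : ∀ i, (p : R) ∉ A i := by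
    intro i h
    rw [aux_map_mem, map_natCast] at h
    exact hpQ h
  have hvinj : ∀ i j : ℕ, i < p - 1 → j < p - 1 → ((v ^ i : ℕ) : ZMod p) = (v ^ j : ℕ) → i = j := by
    intro i j hi hj h
    push_cast at h
    exact pow_injOn_Iio_orderOf (by simpa [hv] using hi) (by simpa [hv] using hj) h
  have hinj : Function.Injective A := by
    intro i j hij
    have hmem : ∀ i, z ^ (v ^ (i : ℕ)) - t ∈ A i := by
      intro i
      rw [aux_map_mem, map_sub, map_intCast, ← hspow, RingEquiv.symm_apply_apply]
      exact ht
    have h1 := hmem i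
    have h2 := hmem j
    rw [← hij] at h2
    have h3 := (A i).sub_mem h1 h2
    rw [sub_sub_sub_cancel_right] at h3
    exact Fin.ext (hvinj i j i.2 j.2 (aux_dist hp hz _ (hA i) (hpA i) _ _ h3))
  set q := Ideal.absNorm (Q : Ideal R) with hq
  have hqpos : 0 < q := Nat.pos_of_ne_zero fun h => hQ0 (Ideal.absNorm_eq_zero_iff.1 h)
  have hNA : ∀ i, Ideal.absNorm (A i) = q := fun i => aux_card_map _ _
  have hqQ : (q : R) ∈ (Q : Ideal R) := Ideal.absNorm_mem (Q : Ideal R)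
  have hqA : ∀ i, (q : R) ∈ A i := by
    intro i
    rw [aux_map_mem, map_natCast]; exact hqQ
  -- classes
  have hmem0 : ∀ i : ℕ, Ideal.map ((s ^ (i : ℕ) : RingAut R) : R ≃+* R) (Q : Ideal R) ∈
      (Ideal R)⁰ := by
    intro i
    apply mem_nonZeroDivisors_of_ne_zero
    intro h
    exact hQ0 ((Ideal.map_eq_bot_iff_of_injective (RingEquiv.injective _)).1 h)
  let A' : ℕ → (Ideal R)⁰ := fun i => ⟨_, hmem0 i⟩
  have hTA : ∀ i : ℕ, (T ^ i) (ClassGroup.mk0 Q) = ClassGroup.mk0 (A' i) := by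
    intro i
    induction i with
    | zero =>
      have : A' 0 = Q := by
        apply Subtype.ext
        ext x
        change x ∈ Ideal.map ((s ^ 0 : RingAut R) : R ≃+* R) (Q : Ideal R) ↔ x ∈ (Q : Ideal R)
        rw [aux_map_mem, pow_zero]
        rfl
      rw [this]; simp
    | succ i ih =>
      rw [pow_succ', MulAut.mul_apply, ih]
      apply hT
      ext x
      simp only [A']
      rw [aux_map_mem, aux_map_mem, aux_map_mem, pow_succ']
      rfl
  have hcls : ∀ (S : Finset (Fin (p - 1))) (J : R), Ideal.span {J} = ∏ i ∈ S, A i →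
      ∏ i ∈ S, (T ^ (i : ℕ)) (ClassGroup.mk0 Q) = 1 := by
    intro S J hJ
    simp_rw [hTA]
    exact aux_cls (fun i : Fin (p - 1) => A' i) S J hJ
  refine aux_group_s12 p hp (fun i => (T ^ (i : ℕ)) (ClassGroup.mk0 Q)) (fun i => N i)
    (fun i => hN i) ?_ ?_
  · intro b hb
    rw [Finset.mem_Icc] at hb
    obtain ⟨J, J', hJJ, hJ⟩ := aux_core_quot (Q : Ideal R) hQ hQ0 hp hz hpQ b hb.1 hb.2
    refine hcls _ J (aux_factor A hA hA0 hinj q hqpos hNA (by rw [hrank]; simp) _ J J' hJJ ?_ ?_)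
    · intro i hi
      rw [aux_map_mem]
      exact (hJ _ (N i) (hsymm i) (hN i).1 (hN i).2).1 (by simpa using hi)
    · intro i hi
      rw [aux_map_mem]
      exact (hJ _ (N i) (hsymm i) (hN i).1 (hN i).2).2 (by simpa using hi)
  · refine hcls _ (q : R) (aux_factor A hA hA0 hinj q hqpos hNA (by rw [hrank]; simp) _ q 1
      (by simp) (fun i _ => hqA i) (fun i hi => absurd (Finset.mem_univ i) hi))

theorem statement12
    (p : ℕ) (hp : p.Prime) (hp2 : p ≠ 2)
    (v : ℕ) (hv1 : 1 ≤ v) (hv2 : v ≤ p - 1)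
    (hv : orderOf (v : ZMod p) = p - 1)
    (vn : ℤ → ℕ)
    (hvn1 : ∀ n : ℤ, 1 ≤ vn n) (hvn2 : ∀ n : ℤ, vn n ≤ p - 1)
    (hvn0 : vn 0 = 1)
    (hvnrec : ∀ n : ℤ, (vn (n + 1) : ZMod p) = (v : ZMod p) * (vn n : ZMod p))
    (K : Type*) [Field K] [NumberField K]
    [IsCyclotomicExtension {p} ℚ K]
    (ζ : K) (hζ : IsPrimitiveRoot ζ p)
    (σ : K ≃ₐ[ℚ] K) (hσ : σ ζ = ζ ^ v)
    (σ' : 𝓞 K ≃+* 𝓞 K)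
    (hσ' : ∀ x : 𝓞 K, algebraMap (𝓞 K) K (σ' x) = σ (algebraMap (𝓞 K) K x))
    (T : MulAut (ClassGroup (𝓞 K)))
    (hT : ∀ I J : (Ideal (𝓞 K))⁰,
      Ideal.map σ' (I : Ideal (𝓞 K)) = (J : Ideal (𝓞 K)) →
      T (ClassGroup.mk0 I) = ClassGroup.mk0 J)
    (h : ℕ) [hh : Fact h.Prime] (hhodd : h ≠ 2) (hhp : h ≠ p)
    (c : ClassGroup (𝓞 K)) (hc1 : c ≠ 1) (hch : c ^ h = 1)
    (hcm : (T ^ ((p - 1) / 2)) c = c⁻¹) :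
    ∀ V : Polynomial (ZMod h), V.Monic →
      (∏ i ∈ V.support, ((T ^ i) c) ^ (V.coeff i).val = 1) →
      (∀ W : Polynomial (ZMod h), W.Monic →
        (∏ i ∈ W.support, ((T ^ i) c) ^ (W.coeff i).val = 1) →
        V.degree ≤ W.degree) →
      (V ∣ ∑ i ∈ Finset.range (p - 1), Polynomial.C ((vn (-(i : ℤ)) : ZMod h)) * Polynomial.X ^ i)
      ∧ (V ∣ Polynomial.X ^ ((p - 1) / 2) + 1)
      ∧ V ∣ EuclideanDomain.gcd
          (∑ i ∈ Finset.range (p - 1), Polynomial.C ((vn (-(i : ℤ)) : ZMod h)) * Polynomial.X ^ i)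
          (Polynomial.X ^ ((p - 1) / 2) + 1) := by
  classical
  have := Fact.mk hp
  have := NeZero.mk hp.ne_zero
  intro V hV hVa hmin
  have hz : IsPrimitiveRoot hζ.toInteger p := hζ.toInteger_isPrimitiveRoot
  have hgen : ∀ x : 𝓞 K, ∃ a : ℤ[X], aeval hζ.toInteger a = x := by
    intro x
    obtain ⟨a, ha⟩ := hζ.integralPowerBasis.exists_eq_aeval' x
    rw [hζ.integralPowerBasis_gen] at ha
    exact ⟨a, ha.symm⟩
  have hrank : Module.finrank ℤ (𝓞 K) = p - 1 := by
    rw [RingOfIntegers.rank, IsCyclotomicExtension.finrank (n := p) K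
      (cyclotomic.irreducible_rat hp.pos), Nat.totient_prime hp]
  have hz1 : Prime (hζ.toInteger - 1) := hζ.zeta_sub_one_prime'
  have hs : σ' hζ.toInteger = hζ.toInteger ^ v := by
    apply RingOfIntegers.coe_injective
    rw [hσ', map_pow]
    exact hσ
  have hNv : ∀ i : ℕ, (vn (-(i : ℤ)) : ZMod p) * (v : ZMod p) ^ i = 1 := by
    intro i
    induction i with
    | zero => simp [hvn0]
    | succ i ih =>
      have h1 := hvnrec (-((i + 1 : ℕ) : ℤ))
      have h2 : -((i + 1 : ℕ) : ℤ) + 1 = -(i : ℤ) := by push_cast; ring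
      rw [h2] at h1
      rw [← ih, h1]; ring
  let f : ClassGroup (𝓞 K) →* ClassGroup (𝓞 K) := ∏ i : Fin (p - 1),
    (powMonoidHom (vn (-((i : ℕ) : ℤ)))).comp (T ^ (i : ℕ)).toMonoidHom
  have hf : ∀ x, f x = ∏ i : Fin (p - 1), ((T ^ (i : ℕ)) x) ^ vn (-((i : ℕ) : ℤ)) := by
    intro x
    simp only [f, MonoidHom.finsetProd_apply]
    rfl
  have hker : c ∈ f.ker := by
    refine aux_gen_top hp hz.pow_eq_one hgen f.ker ?_ c
    rintro Q hQ ⟨t, ht⟩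
    rw [MonoidHom.mem_ker, hf]
    exact aux_stick hp hz hrank hz1 σ' v hs hv (fun i => vn (-(i : ℤ)))
      (fun i => ⟨hvn1 _, hvn2 _⟩) hNv T hT Q hQ t ht
  rw [MonoidHom.mem_ker, hf] at hker
  have hd1 : V ∣ ∑ i ∈ Finset.range (p - 1),
      Polynomial.C ((vn (-(i : ℤ)) : ZMod h)) * Polynomial.X ^ i := by
    have h1 := aux_ann T h c hch V hV hVa hmin
      (∑ i ∈ Finset.range (p - 1), C ((vn (-(i : ℤ)) : ℕ) : ℤ) * X ^ i) (by
        simp only [map_sum, LinearMap.sum_apply, map_mul, map_pow, aeval_X,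
          Module.End.mul_apply, auxEnd_pow, aeval_C, Module.algebraMap_end_apply]
        rw [Finset.sum_range]
        have h2 := congrArg Additive.ofMul hker
        rw [ofMul_prod, ofMul_one] at h2
        rw [← h2]
        refine Finset.sum_congr rfl fun i _ => ?_
        rw [ofMul_pow, natCast_zsmul])
    simpa [Polynomial.map_sum] using h1
  have hd2 : V ∣ Polynomial.X ^ ((p - 1) / 2) + 1 := by
    have h1 := aux_ann T h c hch V hV hVa hmin (X ^ ((p - 1) / 2) + 1) (by
        simp only [map_add, map_pow, aeval_X, map_one, LinearMap.add_apply, auxEnd_pow, hcm,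
          Module.End.one_apply]
        simp)
    simpa using h1
  exact ⟨hd1, hd2, EuclideanDomain.dvd_gcd hd1 hd2⟩
end
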